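/- In the resolvent-sequence setting, if (H2) holds, then for every ε with 0 < ε < β/12: ∫_{4ε}^{β−4ε} |v³ₙ′|² dx → 0 and λₙ² ∫_{5ε}^{β−5ε} |v³ₙ|² dx → 0 as n → ∞. -/

import Mathlib

open Set Filter MeasureTheory

noncomputable section

/-- The resolvent-sequence setting for the locally damped Bresse system with
parameter `ℓ`: a sequence of nonzero frequencies `lam n` with `|lam n| → ∞`,
solutions `Uₙ = (v1,…,v6)` and right-hand sides `Fₙ = (f1,…,f6)` of the resolvent
equations `(lam n)^ℓ (i (lam n) I − 𝒜) Uₙ = Fₙ`, with `‖Uₙ‖_H = 1` and `‖Fₙ‖_H → 0`. -/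
structure BresseSetting (ρ₁ ρ₂ k₁ k₂ k₃ l L β a₀ : ℝ) (ℓ : ℕ) where
  lam : ℕ → ℝ
  v1 : ℕ → ℝ → ℂ
  v2 : ℕ → ℝ → ℂ
  v3 : ℕ → ℝ → ℂ
  v4 : ℕ → ℝ → ℂ
  v5 : ℕ → ℝ → ℂ
  v6 : ℕ → ℝ → ℂ
  f1 : ℕ → ℝ → ℂ
  f2 : ℕ → ℝ → ℂ
  f3 : ℕ → ℝ → ℂ
  f4 : ℕ → ℝ → ℂ
  f5 : ℕ → ℝ → ℂ
  f6 : ℕ → ℝ → ℂ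
  lam_ne : ∀ n, lam n ≠ 0
  lam_tendsto : Tendsto (fun n => |lam n|) atTop atTop
  reg_v1 : ∀ n, ContDiffOn ℝ 2 (v1 n) (Icc 0 L)
  reg_v3 : ∀ n, ContDiffOn ℝ 2 (v3 n) (Icc 0 L)
  reg_v5 : ∀ n, ContDiffOn ℝ 1 (v5 n) (Icc 0 L)
  reg_v5_left : ∀ n, ContDiffOn ℝ 2 (v5 n) (Icc 0 β)
  reg_v5_right : ∀ n, ContDiffOn ℝ 2 (v5 n) (Icc β L)
  reg_v2 : ∀ n, ContDiffOn ℝ 1 (v2 n) (Icc 0 L)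
  reg_v4 : ∀ n, ContDiffOn ℝ 1 (v4 n) (Icc 0 L)
  reg_v6 : ∀ n, ContDiffOn ℝ 1 (v6 n) (Icc 0 L)
  reg_f1 : ∀ n, ContDiffOn ℝ 1 (f1 n) (Icc 0 L)
  reg_f3 : ∀ n, ContDiffOn ℝ 1 (f3 n) (Icc 0 L)
  reg_f5 : ∀ n, ContDiffOn ℝ 1 (f5 n) (Icc 0 L)
  reg_f2 : ∀ n, ContinuousOn (f2 n) (Icc 0 L)
  reg_f4 : ∀ n, ContinuousOn (f4 n) (Icc 0 L)
  reg_f6 : ∀ n, ContinuousOn (f6 n) (Icc 0 L)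
  bc_zero : ∀ n, v1 n 0 = 0 ∧ v2 n 0 = 0 ∧ v3 n 0 = 0 ∧ v4 n 0 = 0 ∧ v5 n 0 = 0 ∧
      v6 n 0 = 0 ∧ f1 n 0 = 0 ∧ f3 n 0 = 0 ∧ f5 n 0 = 0
  bc_L : ∀ n, v1 n L = 0 ∧ v2 n L = 0 ∧ v3 n L = 0 ∧ v4 n L = 0 ∧ v5 n L = 0 ∧
      v6 n L = 0 ∧ f1 n L = 0 ∧ f3 n L = 0 ∧ f5 n L = 0
  eq1 : ∀ n, ∀ x ∈ Ioo (0 : ℝ) β ∪ Ioo β L,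
      Complex.I * (lam n : ℂ) * v1 n x - v2 n x = (lam n : ℂ) ^ (-(ℓ : ℤ)) * f1 n x
  eq2 : ∀ n, ∀ x ∈ Ioo (0 : ℝ) β ∪ Ioo β L,
      Complex.I * (lam n : ℂ) * (ρ₁ : ℂ) * v2 n x
        - (k₁ : ℂ) * deriv (fun y => deriv (v1 n) y + v3 n y + (l : ℂ) * v5 n y) x
        - (l : ℂ) * (k₃ : ℂ) * (deriv (v5 n) x - (l : ℂ) * v1 n x)
        = (ρ₁ : ℂ) * (lam n : ℂ) ^ (-(ℓ : ℤ)) * f2 n x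
  eq3 : ∀ n, ∀ x ∈ Ioo (0 : ℝ) β ∪ Ioo β L,
      Complex.I * (lam n : ℂ) * v3 n x - v4 n x = (lam n : ℂ) ^ (-(ℓ : ℤ)) * f3 n x
  eq4 : ∀ n, ∀ x ∈ Ioo (0 : ℝ) β ∪ Ioo β L,
      Complex.I * (lam n : ℂ) * (ρ₂ : ℂ) * v4 n x
        - (k₂ : ℂ) * deriv (deriv (v3 n)) x
        + (k₁ : ℂ) * (deriv (v1 n) x + v3 n x + (l : ℂ) * v5 n x)
        = (ρ₂ : ℂ) * (lam n : ℂ) ^ (-(ℓ : ℤ)) * f4 n x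
  eq5 : ∀ n, ∀ x ∈ Ioo (0 : ℝ) β ∪ Ioo β L,
      Complex.I * (lam n : ℂ) * v5 n x - v6 n x = (lam n : ℂ) ^ (-(ℓ : ℤ)) * f5 n x
  eq6 : ∀ n, ∀ x ∈ Ioo (0 : ℝ) β ∪ Ioo β L,
      Complex.I * (lam n : ℂ) * (ρ₁ : ℂ) * v6 n x
        - (k₃ : ℂ) * deriv (fun y => deriv (v5 n) y - (l : ℂ) * v1 n y) x
        + (l : ℂ) * (k₁ : ℂ) * (deriv (v1 n) x + v3 n x + (l : ℂ) * v5 n x)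
        + (if x < β then (a₀ : ℂ) else 0) * v6 n x
        = (ρ₁ : ℂ) * (lam n : ℂ) ^ (-(ℓ : ℤ)) * f6 n x
  normU : ∀ n, (∫ x in (0 : ℝ)..L,
      (k₁ * ‖deriv (v1 n) x + v3 n x + (l : ℂ) * v5 n x‖ ^ 2 + ρ₁ * ‖v2 n x‖ ^ 2
        + k₂ * ‖deriv (v3 n) x‖ ^ 2 + ρ₂ * ‖v4 n x‖ ^ 2
        + k₃ * ‖deriv (v5 n) x - (l : ℂ) * v1 n x‖ ^ 2 + ρ₁ * ‖v6 n x‖ ^ 2)) = 1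
  normF : Tendsto (fun n => ∫ x in (0 : ℝ)..L,
      (k₁ * ‖deriv (f1 n) x + f3 n x + (l : ℂ) * f5 n x‖ ^ 2 + ρ₁ * ‖f2 n x‖ ^ 2
        + k₂ * ‖deriv (f3 n) x‖ ^ 2 + ρ₂ * ‖f4 n x‖ ^ 2
        + k₃ * ‖deriv (f5 n) x - (l : ℂ) * f1 n x‖ ^ 2 + ρ₁ * ‖f6 n x‖ ^ 2))
      atTop (nhds 0)


/-- Bounded in `L²(a,b)` along the sequence. -/
def BrBd (a b : ℝ) (u : ℕ → ℝ → ℂ) : Prop :=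
  (∀ n, ContinuousOn (u n) (Icc a b)) ∧ ∃ C : ℝ, ∀ n, ∫ x in a..b, ‖u n x‖ ^ 2 ≤ C

/-- Tending to zero in `L²(a,b)` along the sequence. -/
def BrSm (a b : ℝ) (u : ℕ → ℝ → ℂ) : Prop :=
  (∀ n, ContinuousOn (u n) (Icc a b)) ∧
    Tendsto (fun n => ∫ x in a..b, ‖u n x‖ ^ 2) atTop (nhds 0)

/-- Integral tends to zero. -/
def BrZ (a b : ℝ) (u : ℕ → ℝ → ℂ) : Prop :=
  (∀ n, ContinuousOn (u n) (Icc a b)) ∧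
    Tendsto (fun n => ∫ x in a..b, u n x) atTop (nhds 0)

section general

variable {a b : ℝ} {u w g h : ℕ → ℝ → ℂ}

lemma br_ii {E : Type*} [NormedAddCommGroup E] {f : ℝ → E} (hab : a ≤ b)
    (hf : ContinuousOn f (Icc a b)) : IntervalIntegrable f volume a b := by
  apply ContinuousOn.intervalIntegrable
  rwa [uIcc_of_le hab]

lemma BrZ.congr (hab : a ≤ b) (hu : BrZ a b u) (he : ∀ n, ∀ x ∈ Icc a b, w n x = u n x) :
    BrZ a b w := by
  refine ⟨fun n => (hu.1 n).congr (he n), ?_⟩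
  refine hu.2.congr fun n => ?_
  apply intervalIntegral.integral_congr
  intro x hx
  rw [uIcc_of_le hab] at hx
  exact (he n x hx).symm

lemma BrSm.congr (hab : a ≤ b) (hu : BrSm a b u) (he : ∀ n, ∀ x ∈ Icc a b, w n x = u n x) :
    BrSm a b w := by
  refine ⟨fun n => (hu.1 n).congr (he n), ?_⟩
  refine hu.2.congr fun n => ?_
  apply intervalIntegral.integral_congr
  intro x hx
  rw [uIcc_of_le hab] at hx
  simp only [he n x hx]

lemma BrBd.congr (hab : a ≤ b) (hu : BrBd a b u) (he : ∀ n, ∀ x ∈ Icc a b, w n x = u n x) :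
    BrBd a b w := by
  refine ⟨fun n => (hu.1 n).congr (he n), ?_⟩
  obtain ⟨C, hC⟩ := hu.2
  refine ⟨C, fun n => le_trans (le_of_eq ?_) (hC n)⟩
  apply intervalIntegral.integral_congr
  intro x hx
  rw [uIcc_of_le hab] at hx
  simp only [he n x hx]

lemma BrZ.add (hab : a ≤ b) (hu : BrZ a b u) (hw : BrZ a b w) :
    BrZ a b (fun n x => u n x + w n x) := by
  refine ⟨fun n => (hu.1 n).add (hw.1 n), ?_⟩
  have := hu.2.add hw.2
  rw [add_zero] at this
  refine this.congr fun n => ?_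
  rw [intervalIntegral.integral_add (br_ii hab (hu.1 n)) (br_ii hab (hw.1 n))]

lemma BrZ.smul (c : ℂ) (hu : BrZ a b u) : BrZ a b (fun n x => c * u n x) := by
  refine ⟨fun n => continuousOn_const.mul (hu.1 n), ?_⟩
  have := hu.2.const_mul c
  rw [mul_zero] at this
  refine this.congr fun n => ?_
  rw [intervalIntegral.integral_const_mul]

lemma br_int_nonneg (hab : a ≤ b) (f : ℝ → ℂ) : 0 ≤ ∫ x in a..b, ‖f x‖ ^ 2 :=
  intervalIntegral.integral_nonneg hab fun _ _ => by positivity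

lemma BrSm.bd (hu : BrSm a b u) : BrBd a b u := by
  refine ⟨hu.1, ?_⟩
  obtain ⟨C, hC⟩ := hu.2.bddAbove_range
  exact ⟨C, fun n => hC ⟨n, rfl⟩⟩

lemma br_add_sq (hab : a ≤ b) {f f' : ℝ → ℂ} (hf : ContinuousOn f (Icc a b))
    (hf' : ContinuousOn f' (Icc a b)) :
    ∫ x in a..b, ‖f x + f' x‖ ^ 2 ≤ 2 * (∫ x in a..b, ‖f x‖ ^ 2) + 2 * ∫ x in a..b, ‖f' x‖ ^ 2 := by
  have c1 : IntervalIntegrable (fun x => 2 * ‖f x‖ ^ 2) volume a b :=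
    br_ii hab (continuousOn_const.mul (hf.norm.pow 2))
  have c2 : IntervalIntegrable (fun x => 2 * ‖f' x‖ ^ 2) volume a b :=
    br_ii hab (continuousOn_const.mul (hf'.norm.pow 2))
  rw [← intervalIntegral.integral_const_mul, ← intervalIntegral.integral_const_mul,
    ← intervalIntegral.integral_add c1 c2]
  apply intervalIntegral.integral_mono_on hab (br_ii hab ((hf.add hf').norm.pow 2))
    (br_ii hab ((continuousOn_const.mul (hf.norm.pow 2)).add
      (continuousOn_const.mul (hf'.norm.pow 2))))
  intro x _
  have h1 := norm_add_le (f x) (f' x)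
  have h2 := norm_nonneg (f x + f' x)
  change ‖f x + f' x‖ ^ 2 ≤ 2 * ‖f x‖ ^ 2 + 2 * ‖f' x‖ ^ 2
  nlinarith [sq_nonneg (‖f x‖ - ‖f' x‖)]

lemma BrSm.add (hab : a ≤ b) (hu : BrSm a b u) (hw : BrSm a b w) :
    BrSm a b (fun n x => u n x + w n x) := by
  refine ⟨fun n => (hu.1 n).add (hw.1 n), ?_⟩
  have := (hu.2.const_mul 2).add (hw.2.const_mul 2)
  simp only [mul_zero, add_zero] at this
  exact squeeze_zero (fun n => br_int_nonneg hab _)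
    (fun n => br_add_sq hab (hu.1 n) (hw.1 n)) this

lemma BrBd.add (hab : a ≤ b) (hu : BrBd a b u) (hw : BrBd a b w) :
    BrBd a b (fun n x => u n x + w n x) := by
  refine ⟨fun n => (hu.1 n).add (hw.1 n), ?_⟩
  obtain ⟨C, hC⟩ := hu.2
  obtain ⟨D, hD⟩ := hw.2
  refine ⟨2 * C + 2 * D, fun n => (br_add_sq hab (hu.1 n) (hw.1 n)).trans ?_⟩
  linarith [hC n, hD n]

lemma br_smul_sq (c : ℂ) (f : ℝ → ℂ) :
    ∫ x in a..b, ‖c * f x‖ ^ 2 = ‖c‖ ^ 2 * ∫ x in a..b, ‖f x‖ ^ 2 := by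
  rw [← intervalIntegral.integral_const_mul]
  simp only [norm_mul, mul_pow]

lemma BrSm.smul (c : ℂ) (hu : BrSm a b u) : BrSm a b (fun n x => c * u n x) := by
  refine ⟨fun n => continuousOn_const.mul (hu.1 n), ?_⟩
  have := hu.2.const_mul (‖c‖ ^ 2)
  rw [mul_zero] at this
  exact this.congr fun n => (br_smul_sq c _).symm

lemma BrBd.smul (c : ℂ) (hu : BrBd a b u) : BrBd a b (fun n x => c * u n x) := by
  refine ⟨fun n => continuousOn_const.mul (hu.1 n), ?_⟩
  obtain ⟨C, hC⟩ := hu.2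
  refine ⟨‖c‖ ^ 2 * C, fun n => ?_⟩
  rw [br_smul_sq]
  exact mul_le_mul_of_nonneg_left (hC n) (by positivity)

lemma BrBd.smul_zero (hab : a ≤ b) {c : ℕ → ℂ} (hc : Tendsto c atTop (nhds 0))
    (hu : BrBd a b u) : BrSm a b (fun n x => c n * u n x) := by
  refine ⟨fun n => continuousOn_const.mul (hu.1 n), ?_⟩
  obtain ⟨C, hC⟩ := hu.2
  have h1 : Tendsto (fun n => ‖c n‖ ^ 2 * C) atTop (nhds 0) := by
    have := (hc.norm.pow 2).mul_const C
    simpa using this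
  refine squeeze_zero (fun n => br_int_nonneg hab _) (fun n => ?_) h1
  rw [br_smul_sq]
  exact mul_le_mul_of_nonneg_left (hC n) (by positivity)

lemma br_mono_int {a' b' : ℝ} (ha : a ≤ a') (hab' : a' ≤ b') (hb : b' ≤ b) {f : ℝ → ℂ}
    (hf : ContinuousOn f (Icc a b)) :
    ∫ x in a'..b', ‖f x‖ ^ 2 ≤ ∫ x in a..b, ‖f x‖ ^ 2 := by
  apply intervalIntegral.integral_mono_interval ha hab' hb
  · filter_upwards with x
    positivity
  · exact br_ii (ha.trans (hab'.trans hb)) (hf.norm.pow 2)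

lemma BrSm.mono {a' b' : ℝ} (hu : BrSm a b u) (ha : a ≤ a') (hab' : a' ≤ b') (hb : b' ≤ b) :
    BrSm a' b' u :=
  ⟨fun n => (hu.1 n).mono (Icc_subset_Icc ha hb),
    squeeze_zero (fun n => br_int_nonneg hab' _) (fun n => br_mono_int ha hab' hb (hu.1 n)) hu.2⟩

lemma BrBd.mono {a' b' : ℝ} (hu : BrBd a b u) (ha : a ≤ a') (hab' : a' ≤ b') (hb : b' ≤ b) :
    BrBd a' b' u := by
  refine ⟨fun n => (hu.1 n).mono (Icc_subset_Icc ha hb), ?_⟩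
  obtain ⟨C, hC⟩ := hu.2
  exact ⟨C, fun n => (br_mono_int ha hab' hb (hu.1 n)).trans (hC n)⟩

lemma BrSm.int_mul (hab : a ≤ b) (hg : BrSm a b g) (hh : BrBd a b h) :
    Tendsto (fun n => ∫ x in a..b, ‖g n x‖ * ‖h n x‖) atTop (nhds 0) := by
  obtain ⟨C, hC⟩ := hh.2
  have hC0 : 0 ≤ C := (br_int_nonneg hab (h 0)).trans (hC 0)
  rw [Metric.tendsto_atTop]
  intro ε hε
  set s : ℝ := ε / (2 * (C + 1)) with hs
  have hs0 : 0 < s := by positivity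
  obtain ⟨N, hN⟩ := (Metric.tendsto_atTop.1 hg.2) (s * ε / 2) (by positivity)
  refine ⟨N, fun n hn => ?_⟩
  have h1 := hN n hn
  rw [Real.dist_eq, sub_zero, abs_of_nonneg (br_int_nonneg hab _)] at h1
  have h0 : 0 ≤ ∫ x in a..b, ‖g n x‖ * ‖h n x‖ :=
    intervalIntegral.integral_nonneg hab fun _ _ => by positivity
  rw [Real.dist_eq, sub_zero, abs_of_nonneg h0]
  have c1 : IntervalIntegrable (fun x => s⁻¹ * ‖g n x‖ ^ 2) volume a b :=
    br_ii hab (continuousOn_const.mul ((hg.1 n).norm.pow 2))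
  have c2 : IntervalIntegrable (fun x => s * ‖h n x‖ ^ 2) volume a b :=
    br_ii hab (continuousOn_const.mul ((hh.1 n).norm.pow 2))
  have h2 : ∫ x in a..b, ‖g n x‖ * ‖h n x‖ ≤
      s⁻¹ * (∫ x in a..b, ‖g n x‖ ^ 2) + s * ∫ x in a..b, ‖h n x‖ ^ 2 := by
    rw [← intervalIntegral.integral_const_mul, ← intervalIntegral.integral_const_mul,
      ← intervalIntegral.integral_add c1 c2]
    apply intervalIntegral.integral_mono_on hab (br_ii hab ((hg.1 n).norm.mul (hh.1 n).norm))
      (c1.add c2)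
    intro x _
    have e : s⁻¹ * ‖g n x‖ ^ 2 + s * ‖h n x‖ ^ 2 - ‖g n x‖ * ‖h n x‖
        = s⁻¹ * ((‖g n x‖ - s * ‖h n x‖ / 2) ^ 2 + 3 / 4 * (s * ‖h n x‖) ^ 2) := by
      field_simp
      ring
    have : 0 ≤ s⁻¹ * ((‖g n x‖ - s * ‖h n x‖ / 2) ^ 2 + 3 / 4 * (s * ‖h n x‖) ^ 2) := by
      positivity
    change ‖g n x‖ * ‖h n x‖ ≤ s⁻¹ * ‖g n x‖ ^ 2 + s * ‖h n x‖ ^ 2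
    linarith
  have h3 : s⁻¹ * (∫ x in a..b, ‖g n x‖ ^ 2) < s⁻¹ * (s * ε / 2) :=
    mul_lt_mul_of_pos_left h1 (by positivity)
  have h4 : s⁻¹ * (s * ε / 2) = ε / 2 := by field_simp
  have h5 : s * ∫ x in a..b, ‖h n x‖ ^ 2 ≤ s * C := mul_le_mul_of_nonneg_left (hC n) hs0.le
  have h6 : s * C ≤ ε / 2 := by
    rw [hs, div_mul_eq_mul_div, div_le_div_iff₀ (by positivity) (by norm_num)]
    nlinarith
  linarith

/-- small times bounded, with a fixed continuous weight -/
lemma BrSm.mul (hab : a ≤ b) (c : ℝ → ℂ) (hc : Continuous c) (hg : BrSm a b g)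
    (hh : BrBd a b h) : BrZ a b (fun n x => c x * (g n x * (starRingEnd ℂ) (h n x))) := by
  have hcont : ∀ n, ContinuousOn (fun x => c x * (g n x * (starRingEnd ℂ) (h n x))) (Icc a b) :=
    fun n => hc.continuousOn.mul ((hg.1 n).mul
      (Complex.continuous_conj.comp_continuousOn (hh.1 n)))
  refine ⟨hcont, ?_⟩
  obtain ⟨M, hM⟩ := isCompact_Icc.exists_bound_of_continuousOn (hc.continuousOn (s := Icc a b))
  have h1 := (hg.int_mul hab hh).const_mul M
  rw [mul_zero] at h1
  apply squeeze_zero_norm _ h1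
  intro n
  refine (intervalIntegral.norm_integral_le_integral_norm hab).trans ?_
  rw [← intervalIntegral.integral_const_mul]
  apply intervalIntegral.integral_mono_on hab (br_ii hab (hcont n).norm)
    (br_ii hab (continuousOn_const.mul ((hg.1 n).norm.mul (hh.1 n).norm)))
  intro x hx
  rw [norm_mul, norm_mul, RCLike.norm_conj]
  exact mul_le_mul_of_nonneg_right (hM x hx) (by positivity)

lemma BrSm.mul_left (hab : a ≤ b) (c : ℝ → ℂ) (hc : Continuous c) (hg : BrSm a b g)
    (hh : BrBd a b h) : BrZ a b (fun n x => c x * (h n x * (starRingEnd ℂ) (g n x))) := by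
  have h1 := hg.mul hab (fun x => (starRingEnd ℂ) (c x))
    (Complex.continuous_conj.comp hc) hh
  refine ⟨fun n => hc.continuousOn.mul ((hh.1 n).mul
      (Complex.continuous_conj.comp_continuousOn (hg.1 n))), ?_⟩
  have h2 := (Complex.continuous_conj.tendsto 0).comp h1.2
  rw [map_zero] at h2
  refine h2.congr fun n => ?_
  simp only [Function.comp]
  rw [← intervalIntegral.intervalIntegral_conj]
  apply intervalIntegral.integral_congr
  intro x _
  simp only [map_mul, Complex.conj_conj]
  ring

/-- cutoff -/
def brEta (a b : ℝ) (x : ℝ) : ℂ := (((x - a) * (b - x) : ℝ) : ℂ)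
/-- derivative of the cutoff -/
def brEtb (a b : ℝ) (x : ℝ) : ℂ := ((a + b - 2 * x : ℝ) : ℂ)

lemma brEta_cont : Continuous (brEta a b) := by
  unfold brEta; fun_prop
lemma brEtb_cont : Continuous (brEtb a b) := by
  unfold brEtb; fun_prop

lemma brEta_deriv (x : ℝ) : HasDerivAt (brEta a b) (brEtb a b x) x := by
  have : HasDerivAt (fun x : ℝ => (x - a) * (b - x)) (a + b - 2 * x) x := by
    have := ((hasDerivAt_id x).sub_const a).mul ((hasDerivAt_id x).const_sub b)
    exact this.congr_deriv (by simp only [id]; ring)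
  exact this.ofReal_comp

/-- integration by parts against the cutoff -/
lemma br_ibp (hab : a ≤ b) {u p w r : ℕ → ℝ → ℂ}
    (hu : ∀ n, ∀ x ∈ Icc a b, HasDerivAt (u n) (p n x) x)
    (hw : ∀ n, ∀ x ∈ Icc a b, HasDerivAt (w n) (r n x) x)
    (hp : ∀ n, ContinuousOn (p n) (Icc a b)) (hr : ∀ n, ContinuousOn (r n) (Icc a b)) :
    BrZ a b (fun n x => brEta a b x * (p n x * (starRingEnd ℂ) (w n x))
      + brEta a b x * (u n x * (starRingEnd ℂ) (r n x))
      + brEtb a b x * (u n x * (starRingEnd ℂ) (w n x))) := by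
  have cu : ∀ n, ContinuousOn (u n) (Icc a b) := fun n x hx =>
    (hu n x hx).continuousAt.continuousWithinAt
  have cw : ∀ n, ContinuousOn (w n) (Icc a b) := fun n x hx =>
    (hw n x hx).continuousAt.continuousWithinAt
  have cw' : ∀ n, ContinuousOn (fun x => (starRingEnd ℂ) (w n x)) (Icc a b) := fun n =>
    Complex.continuous_conj.comp_continuousOn (cw n)
  have cr' : ∀ n, ContinuousOn (fun x => (starRingEnd ℂ) (r n x)) (Icc a b) := fun n =>
    Complex.continuous_conj.comp_continuousOn (hr n)
  have hc : ∀ n, ContinuousOn (fun x => brEta a b x * (p n x * (starRingEnd ℂ) (w n x))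
      + brEta a b x * (u n x * (starRingEnd ℂ) (r n x))
      + brEtb a b x * (u n x * (starRingEnd ℂ) (w n x))) (Icc a b) := fun n =>
    ((brEta_cont.continuousOn.mul ((hp n).mul (cw' n))).add
      (brEta_cont.continuousOn.mul ((cu n).mul (cr' n)))).add
      (brEtb_cont.continuousOn.mul ((cu n).mul (cw' n)))
  refine ⟨hc, ?_⟩
  have : ∀ n, ∫ x in a..b, (brEta a b x * (p n x * (starRingEnd ℂ) (w n x))
      + brEta a b x * (u n x * (starRingEnd ℂ) (r n x))
      + brEtb a b x * (u n x * (starRingEnd ℂ) (w n x))) = 0 := by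
    intro n
    rw [intervalIntegral.integral_eq_sub_of_hasDerivAt
      (f := fun x => brEta a b x * (u n x * (starRingEnd ℂ) (w n x))) _ (br_ii hab (hc n))]
    · simp [brEta]
    · intro x hx
      rw [uIcc_of_le hab] at hx
      have h1 := (hw n x hx).star
      have h2 := (brEta_deriv (a := a) (b := b) x).mul ((hu n x hx).mul h1)
      refine h2.congr_deriv ?_
      simp only [starRingEnd_apply, Pi.mul_apply]
      ring
  simp only [this]
  exact tendsto_const_nhds

/-- positivity of the cutoff -/
lemma br_shrink {d : ℝ} (hd : 0 < d) (hab : a + d ≤ b - d)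
    (hu : ∀ n, ContinuousOn (u n) (Icc a b))
    (hz : BrZ a b (fun n x => brEta a b x * (u n x * (starRingEnd ℂ) (u n x)))) :
    BrSm (a + d) (b - d) u := by
  have hab0 : a ≤ b := by linarith
  refine ⟨fun n => (hu n).mono (Icc_subset_Icc (by linarith) (by linarith)), ?_⟩
  have e : ∀ n, ∫ x in a..b, brEta a b x * (u n x * (starRingEnd ℂ) (u n x))
      = ((∫ x in a..b, ((x - a) * (b - x)) * ‖u n x‖ ^ 2 : ℝ) : ℂ) := by
    intro n
    rw [← intervalIntegral.integral_ofReal]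
    apply intervalIntegral.integral_congr
    intro x _
    simp only [brEta, Complex.mul_conj, Complex.normSq_eq_norm_sq]
    push_cast
    ring
  have h1 : Tendsto (fun n => ∫ x in a..b, ((x - a) * (b - x)) * ‖u n x‖ ^ 2) atTop
      (nhds 0) := by
    have := hz.2
    simp only [e] at this
    have h := (Complex.continuous_re.tendsto 0).comp this
    simpa [Function.comp_def] using h
  have h2 := h1.const_mul ((d ^ 2)⁻¹)
  rw [mul_zero] at h2
  refine squeeze_zero (fun n => br_int_nonneg hab _) (fun n => ?_) h2
  have hw : ContinuousOn (fun x : ℝ => (x - a) * (b - x)) (Icc a b) := by fun_prop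
  have hc : ContinuousOn (fun x : ℝ => ((x - a) * (b - x)) * ‖u n x‖ ^ 2) (Icc a b) :=
    hw.mul ((hu n).norm.pow 2)
  have hsub : Icc (a + d) (b - d) ⊆ Icc a b := Icc_subset_Icc (by linarith) (by linarith)
  have h3 : ∫ x in (a + d)..(b - d), ((x - a) * (b - x)) * ‖u n x‖ ^ 2
      ≤ ∫ x in a..b, ((x - a) * (b - x)) * ‖u n x‖ ^ 2 := by
    apply intervalIntegral.integral_mono_interval (by linarith) hab (by linarith)
    · rw [Filter.EventuallyLE, ae_restrict_iff' measurableSet_Ioc]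
      filter_upwards with x hx
      have := hx.1
      have := hx.2
      have : 0 ≤ (x - a) * (b - x) := mul_nonneg (by linarith) (by linarith)
      simp only [Pi.zero_apply]
      positivity
    · exact br_ii hab0 hc
  have h4 : d ^ 2 * ∫ x in (a + d)..(b - d), ‖u n x‖ ^ 2
      ≤ ∫ x in (a + d)..(b - d), ((x - a) * (b - x)) * ‖u n x‖ ^ 2 := by
    rw [← intervalIntegral.integral_const_mul]
    apply intervalIntegral.integral_mono_on hab
      (br_ii hab (continuousOn_const.mul (((hu n).mono hsub).norm.pow 2)))
      (br_ii hab (hc.mono hsub))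
    intro x hx
    refine mul_le_mul_of_nonneg_right ?_ (sq_nonneg _)
    nlinarith [hx.1, hx.2]
  rw [inv_mul_eq_div, le_div_iff₀ (by positivity)]
  linarith

end general

lemma br_caccio {a b d ρ k : ℝ} (hd : 0 < d) (hab : a + d ≤ b - d) (hρ : 0 < ρ)
    {lam : ℕ → ℝ} (lam_ne : ∀ n, lam n ≠ 0) (hinv : Tendsto (fun n => ((lam n : ℂ))⁻¹) atTop (nhds 0))
    {u p q B : ℕ → ℝ → ℂ}
    (hu : ∀ n, ∀ x ∈ Icc a b, HasDerivAt (u n) (p n x) x)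
    (hp : ∀ n, ∀ x ∈ Icc a b, HasDerivAt (p n) (q n x) x)
    (hq : ∀ n, ContinuousOn (q n) (Icc a b))
    (he : ∀ n, ∀ x ∈ Icc a b, (k : ℂ) * q n x = -(ρ : ℂ) * ((lam n : ℂ) ^ 2 * u n x) + B n x)
    (hB : BrBd a b B) (hsp : BrSm a b p) (hlu : BrBd a b (fun n x => (lam n : ℂ) * u n x)) :
    BrSm (a + d) (b - d) (fun n x => (lam n : ℂ) * u n x) := by
  have hab0 : a ≤ b := by linarith
  have hsu : BrSm a b u := by
    refine (hlu.smul_zero hab0 hinv).congr hab0 fun n x _ => ?_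
    have : (lam n : ℂ) ≠ 0 := by exact_mod_cast lam_ne n
    field_simp
  have cp := hsp.1
  apply br_shrink hd hab hlu.1
  have z1 := br_ibp hab0 hp hu hq cp
  have z2 := hsp.mul hab0 _ (brEta_cont (a := a) (b := b)) hsp.bd
  have z3 := hsp.mul hab0 _ (brEtb_cont (a := a) (b := b)) hsu.bd
  have z4 := hsu.mul_left hab0 _ (brEta_cont (a := a) (b := b)) hB
  have z := ((((z1.smul (-k)).add hab0 (z2.smul k)).add hab0 (z3.smul k)).add hab0 z4).smul
    ((ρ : ℂ)⁻¹)
  refine z.congr hab0 fun n x hx => ?_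
  have e := he n x hx
  have hρ' : (ρ : ℂ) ≠ 0 := by exact_mod_cast hρ.ne'
  rw [eq_inv_mul_iff_mul_eq₀ hρ']
  simp only [map_mul, Complex.conj_ofReal]
  linear_combination (brEta a b x * (starRingEnd ℂ) (u n x)) * e

/-- the local system on an interval where the damping acts -/
structure BrLoc (ρ₁ ρ₂ k₁ k₂ k₃ l : ℝ) (lam : ℕ → ℝ)
    (u1 u3 u5 p1 p3 p5 q1 q3 q5 g1 g3 g5 : ℕ → ℝ → ℂ) (a b : ℝ) : Prop where
  hab : a ≤ b
  hu1 : ∀ n, ∀ x ∈ Icc a b, HasDerivAt (u1 n) (p1 n x) x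
  hu3 : ∀ n, ∀ x ∈ Icc a b, HasDerivAt (u3 n) (p3 n x) x
  hu5 : ∀ n, ∀ x ∈ Icc a b, HasDerivAt (u5 n) (p5 n x) x
  hp1 : ∀ n, ∀ x ∈ Icc a b, HasDerivAt (p1 n) (q1 n x) x
  hp3 : ∀ n, ∀ x ∈ Icc a b, HasDerivAt (p3 n) (q3 n x) x
  hp5 : ∀ n, ∀ x ∈ Icc a b, HasDerivAt (p5 n) (q5 n x) x
  cq1 : ∀ n, ContinuousOn (q1 n) (Icc a b)
  cq3 : ∀ n, ContinuousOn (q3 n) (Icc a b)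
  cq5 : ∀ n, ContinuousOn (q5 n) (Icc a b)
  e1 : ∀ n, ∀ x ∈ Icc a b, (k₁ : ℂ) * q1 n x = -(ρ₁ : ℂ) * ((lam n : ℂ) ^ 2 * u1 n x)
    + (-(k₁ : ℂ) * p3 n x + (-((l * (k₁ + k₃) : ℝ) : ℂ) * p5 n x + g1 n x))
  e3 : ∀ n, ∀ x ∈ Icc a b, (k₂ : ℂ) * q3 n x = -(ρ₂ : ℂ) * ((lam n : ℂ) ^ 2 * u3 n x)
    + ((k₁ : ℂ) * p1 n x + g3 n x)
  e5 : ∀ n, ∀ x ∈ Icc a b, (k₃ : ℂ) * q5 n x = -(ρ₁ : ℂ) * ((lam n : ℂ) ^ 2 * u5 n x)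
    + (((l * (k₁ + k₃) : ℝ) : ℂ) * p1 n x + g5 n x)
  sg1 : BrSm a b g1
  sg3 : BrSm a b g3
  sg5 : BrSm a b g5
  bp1 : BrBd a b p1
  bp3 : BrBd a b p3
  bp5 : BrBd a b p5
  bu1 : BrBd a b (fun n x => (lam n : ℂ) * u1 n x)
  bu3 : BrBd a b (fun n x => (lam n : ℂ) * u3 n x)
  su5 : BrSm a b (fun n x => (lam n : ℂ) ^ 2 * u5 n x)

section loc

variable {ρ₁ ρ₂ k₁ k₂ k₃ l : ℝ} {lam : ℕ → ℝ}
    {u1 u3 u5 p1 p3 p5 q1 q3 q5 g1 g3 g5 : ℕ → ℝ → ℂ} {a b : ℝ}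

lemma BrLoc.mono (S : BrLoc ρ₁ ρ₂ k₁ k₂ k₃ l lam u1 u3 u5 p1 p3 p5 q1 q3 q5 g1 g3 g5 a b)
    {a' b' : ℝ} (ha : a ≤ a') (hab' : a' ≤ b') (hb : b' ≤ b) :
    BrLoc ρ₁ ρ₂ k₁ k₂ k₃ l lam u1 u3 u5 p1 p3 p5 q1 q3 q5 g1 g3 g5 a' b' := by
  have hs : Icc a' b' ⊆ Icc a b := Icc_subset_Icc ha hb
  exact
  { hab := hab'
    hu1 := fun n x hx => S.hu1 n x (hs hx)
    hu3 := fun n x hx => S.hu3 n x (hs hx)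
    hu5 := fun n x hx => S.hu5 n x (hs hx)
    hp1 := fun n x hx => S.hp1 n x (hs hx)
    hp3 := fun n x hx => S.hp3 n x (hs hx)
    hp5 := fun n x hx => S.hp5 n x (hs hx)
    cq1 := fun n => (S.cq1 n).mono hs
    cq3 := fun n => (S.cq3 n).mono hs
    cq5 := fun n => (S.cq5 n).mono hs
    e1 := fun n x hx => S.e1 n x (hs hx)
    e3 := fun n x hx => S.e3 n x (hs hx)
    e5 := fun n x hx => S.e5 n x (hs hx)
    sg1 := S.sg1.mono ha hab' hb
    sg3 := S.sg3.mono ha hab' hb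
    sg5 := S.sg5.mono ha hab' hb
    bp1 := S.bp1.mono ha hab' hb
    bp3 := S.bp3.mono ha hab' hb
    bp5 := S.bp5.mono ha hab' hb
    bu1 := S.bu1.mono ha hab' hb
    bu3 := S.bu3.mono ha hab' hb
    su5 := S.su5.mono ha hab' hb }

lemma BrLoc.step2 (S : BrLoc ρ₁ ρ₂ k₁ k₂ k₃ l lam u1 u3 u5 p1 p3 p5 q1 q3 q5 g1 g3 g5 a b)
    (hk3 : 0 < k₃) {d : ℝ} (hd : 0 < d) (hab : a + d ≤ b - d) :
    BrSm (a + d) (b - d) (fun n x => (lam n : ℂ) * p5 n x) := by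
  have hab0 := S.hab
  apply br_shrink (u := fun n x => (lam n : ℂ) * p5 n x) hd hab
    (fun n => continuousOn_const.mul (S.bp5.1 n))
  have hk : (k₃ : ℂ) ≠ 0 := by exact_mod_cast hk3.ne'
  have bq5 : BrBd a b q5 := by
    refine (((S.su5.bd.smul (-(ρ₁ : ℂ))).add hab0
      ((S.bp1.smul ((l * (k₁ + k₃) : ℝ) : ℂ)).add hab0 S.sg5.bd)).smul ((k₃ : ℂ)⁻¹)).congr hab0 ?_
    intro n x hx
    rw [eq_inv_mul_iff_mul_eq₀ hk]
    exact S.e5 n x hx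
  have z1 := br_ibp hab0 S.hp5
    (w := fun n x => (lam n : ℂ) ^ 2 * u5 n x) (r := fun n x => (lam n : ℂ) ^ 2 * p5 n x)
    (fun n x hx => (S.hu5 n x hx).const_mul _) S.cq5
    (fun n => continuousOn_const.mul (S.bp5.1 n))
  have z2 := S.su5.mul_left hab0 _ (brEtb_cont (a := a) (b := b)) S.bp5
  have z3 := S.su5.mul_left hab0 _ (brEta_cont (a := a) (b := b)) bq5
  refine ((z1.add hab0 (z2.smul (-1))).add hab0 (z3.smul (-1))).congr hab0 fun n x hx => ?_
  simp only [map_mul, map_pow, Complex.conj_ofReal]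
  ring

lemma BrLoc.step3 (S : BrLoc ρ₁ ρ₂ k₁ k₂ k₃ l lam u1 u3 u5 p1 p3 p5 q1 q3 q5 g1 g3 g5 a b)
    (hk1 : 0 < k₁) (hk3 : 0 < k₃) (hl : 0 < l) (lam_ne : ∀ n, lam n ≠ 0)
    (hinv : Tendsto (fun n => ((lam n : ℂ))⁻¹) atTop (nhds 0))
    (hs : BrSm a b (fun n x => (lam n : ℂ) * p5 n x))
    {d : ℝ} (hd : 0 < d) (hab : a + d ≤ b - d) :
    BrSm (a + d) (b - d) p1 := by
  have hab0 := S.hab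
  apply br_shrink hd hab S.bp1.1
  have hl0 : ∀ n, (lam n : ℂ) ≠ 0 := fun n => by exact_mod_cast lam_ne n
  have hk : (k₁ : ℂ) ≠ 0 := by exact_mod_cast hk1.ne'
  have hc : ((l * (k₁ + k₃) : ℝ) : ℂ) ≠ 0 := by
    have : l * (k₁ + k₃) ≠ 0 := by positivity
    exact_mod_cast this
  have sp5 : BrSm a b p5 := by
    refine (hs.bd.smul_zero hab0 hinv).congr hab0 fun n x _ => ?_
    have := hl0 n
    field_simp
  have bq1 : BrBd a b (fun n x => (lam n : ℂ)⁻¹ * q1 n x) := by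
    have h1 := ((S.bp3.smul (-(k₁ : ℂ))).add hab0
      ((S.bp5.smul (-((l * (k₁ + k₃) : ℝ) : ℂ))).add hab0 S.sg1.bd)).smul_zero hab0 hinv
    refine (((S.bu1.smul (-(ρ₁ : ℂ))).add hab0 h1.bd).smul ((k₁ : ℂ)⁻¹)).congr hab0 ?_
    intro n x hx
    rw [eq_inv_mul_iff_mul_eq₀ hk]
    have e := S.e1 n x hx
    have h2 : (lam n : ℂ)⁻¹ * (lam n : ℂ) = 1 := inv_mul_cancel₀ (hl0 n)
    linear_combination (lam n : ℂ)⁻¹ * e - (ρ₁ : ℂ) * lam n * u1 n x * h2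
  have sS : BrSm a b (fun n x => (ρ₁ : ℂ) * ((lam n : ℂ) ^ 2 * u5 n x) + (-1) * g5 n x) :=
    (S.su5.smul _).add hab0 (S.sg5.smul _)
  have z1 := br_ibp hab0 S.hp5 S.hp1 S.cq5 S.cq1
  have z2 := hs.mul hab0 _ (brEta_cont (a := a) (b := b)) bq1
  have z3 := sp5.mul hab0 _ (brEtb_cont (a := a) (b := b)) S.bp1
  have z4 := sS.mul hab0 _ (brEta_cont (a := a) (b := b)) S.bp1
  refine (((((z1.smul k₃).add hab0 (z2.smul (-k₃))).add hab0 (z3.smul (-k₃))).add hab0 z4).smul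
    (((l * (k₁ + k₃) : ℝ) : ℂ)⁻¹)).congr hab0 fun n x hx => ?_
  rw [eq_inv_mul_iff_mul_eq₀ hc]
  simp only [map_mul, map_inv₀, Complex.conj_ofReal]
  have e := S.e5 n x hx
  have h2 : (lam n : ℂ)⁻¹ * (lam n : ℂ) = 1 := inv_mul_cancel₀ (hl0 n)
  linear_combination (-brEta a b x * (starRingEnd ℂ) (p1 n x)) * e
    + (k₃ : ℂ) * brEta a b x * p5 n x * (starRingEnd ℂ) (q1 n x) * h2

lemma BrLoc.step5 (S : BrLoc ρ₁ ρ₂ k₁ k₂ k₃ l lam u1 u3 u5 p1 p3 p5 q1 q3 q5 g1 g3 g5 a b)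
    (hk1 : 0 < k₁) (hk2 : 0 < k₂) (hkr : k₁ * ρ₂ = k₂ * ρ₁)
    (sp5 : BrSm a b p5) (sp1 : BrSm a b p1)
    (su1 : BrSm a b (fun n x => (lam n : ℂ) * u1 n x))
    {d : ℝ} (hd : 0 < d) (hab : a + d ≤ b - d) :
    BrSm (a + d) (b - d) p3 := by
  have hab0 := S.hab
  apply br_shrink hd hab S.bp3.1
  have hk : (k₁ : ℂ) ≠ 0 := by exact_mod_cast hk1.ne'
  have hk' : (k₂ : ℂ) ≠ 0 := by exact_mod_cast hk2.ne'
  have hkr' : (k₁ : ℂ) * ρ₂ = k₂ * ρ₁ := by exact_mod_cast hkr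
  have bB : BrBd a b (fun n x => (k₁ : ℂ) * q3 n x + (ρ₁ : ℂ) * ((lam n : ℂ) ^ 2 * u3 n x)) := by
    refine (((S.bp1.smul (k₁ : ℂ)).add hab0 S.sg3.bd).smul ((k₁ : ℂ) * (k₂ : ℂ)⁻¹)).congr hab0 ?_
    intro n x hx
    have e := S.e3 n x hx
    have h2 : (k₂ : ℂ)⁻¹ * k₂ = 1 := inv_mul_cancel₀ hk'
    linear_combination (k₁ : ℂ) * (k₂ : ℂ)⁻¹ * e
      - ((k₁ : ℂ) * q3 n x + ρ₁ * ((lam n : ℂ) ^ 2 * u3 n x)) * h2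
      - (k₂ : ℂ)⁻¹ * ((lam n : ℂ) ^ 2 * u3 n x) * hkr'
  have sS : BrSm a b (fun n x => -((l * (k₁ + k₃) : ℝ) : ℂ) * p5 n x + g1 n x) :=
    (sp5.smul _).add hab0 S.sg1
  have z1 := br_ibp hab0 S.hp1 S.hp3 S.cq1 S.cq3
  have z2 := br_ibp hab0 S.hu1
    (w := fun n x => (lam n : ℂ) ^ 2 * u3 n x) (r := fun n x => (lam n : ℂ) ^ 2 * p3 n x)
    (fun n x hx => (S.hu3 n x hx).const_mul _) S.bp1.1
    (fun n => continuousOn_const.mul (S.bp3.1 n))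
  have z3 := sp1.mul hab0 _ (brEtb_cont (a := a) (b := b)) S.bp3
  have z4 := su1.mul hab0 _ (brEtb_cont (a := a) (b := b)) S.bu3
  have z5 := sS.mul hab0 _ (brEta_cont (a := a) (b := b)) S.bp3
  have z6 := sp1.mul hab0 _ (brEta_cont (a := a) (b := b)) bB
  refine (((((((z1.smul (-k₁)).add hab0 (z2.smul (-ρ₁))).add hab0 (z3.smul k₁)).add hab0
    (z4.smul ρ₁)).add hab0 z5).add hab0 z6).smul ((k₁ : ℂ)⁻¹)).congr hab0 fun n x hx => ?_
  rw [eq_inv_mul_iff_mul_eq₀ hk]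
  simp only [map_mul, map_add, map_pow, Complex.conj_ofReal]
  have e := S.e1 n x hx
  linear_combination (brEta a b x * (starRingEnd ℂ) (p3 n x)) * e

lemma BrLoc.final (S : BrLoc ρ₁ ρ₂ k₁ k₂ k₃ l lam u1 u3 u5 p1 p3 p5 q1 q3 q5 g1 g3 g5 a b)
    (hr1 : 0 < ρ₁) (hr2 : 0 < ρ₂)
    (hk1 : 0 < k₁) (hk2 : 0 < k₂) (hk3 : 0 < k₃) (hl : 0 < l) (lam_ne : ∀ n, lam n ≠ 0)
    (hinv : Tendsto (fun n => ((lam n : ℂ))⁻¹) atTop (nhds 0)) (hkr : k₁ * ρ₂ = k₂ * ρ₁)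
    {d : ℝ} (hd : 0 < d) (hab : a + 5 * d ≤ b - 5 * d) :
    BrSm (a + 4 * d) (b - 4 * d) p3 ∧
      BrSm (a + 5 * d) (b - 5 * d) (fun n x => (lam n : ℂ) * u3 n x) := by
  have hl0 : ∀ n, (lam n : ℂ) ≠ 0 := fun n => by exact_mod_cast lam_ne n
  have s1 := S.step2 hk3 hd (by linarith)
  have S1 := S.mono (a' := a + d) (b' := b - d) (by linarith) (by linarith) (by linarith)
  have sp5 : BrSm (a + d) (b - d) p5 := by
    refine (s1.bd.smul_zero S1.hab hinv).congr S1.hab fun n x _ => ?_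
    have := hl0 n
    field_simp
  have s2 := S1.step3 hk1 hk3 hl lam_ne hinv s1 hd (by linarith)
  have S2 := S1.mono (a' := a + d + d) (b' := b - d - d) (by linarith) (by linarith) (by linarith)
  have s3 := br_caccio hd (by linarith) hr1 lam_ne hinv S2.hu1 S2.hp1 S2.cq1 S2.e1
    ((S2.bp3.smul (-(k₁ : ℂ))).add S2.hab
      ((S2.bp5.smul (-((l * (k₁ + k₃) : ℝ) : ℂ))).add S2.hab S2.sg1.bd)) s2 S2.bu1
  have S3 := S2.mono (a' := a + d + d + d) (b' := b - d - d - d) (by linarith) (by linarith)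
    (by linarith)
  have s4 := S3.step5 hk1 hk2 hkr (sp5.mono (by linarith) (by linarith) (by linarith))
    (s2.mono (by linarith) (by linarith) (by linarith)) s3 hd (by linarith)
  have S4 := S3.mono (a' := a + d + d + d + d) (b' := b - d - d - d - d) (by linarith)
    (by linarith) (by linarith)
  have s5 := br_caccio hd (by linarith) hr2 lam_ne hinv S4.hu3 S4.hp3 S4.cq3 S4.e3
    ((S4.bp1.smul _).add S4.hab S4.sg3.bd) s4 S4.bu3
  exact ⟨s4.mono (by linarith) (by linarith) (by linarith),
    s5.mono (by linarith) (by linarith) (by linarith)⟩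

end loc

lemma br_bd_of {a b c C : ℝ} (hab : a ≤ b) (hc : 0 < c) {A : ℕ → ℝ → ℂ} {G : ℕ → ℝ → ℝ}
    (hA : ∀ n, ContinuousOn (A n) (Icc a b)) (hG : ∀ n, ContinuousOn (G n) (Icc a b))
    (h : ∀ n, ∀ x ∈ Icc a b, c * ‖A n x‖ ^ 2 ≤ G n x) (hI : ∀ n, ∫ x in a..b, G n x = C) :
    BrBd a b A := by
  refine ⟨hA, c⁻¹ * C, fun n => ?_⟩
  rw [inv_mul_eq_div, le_div_iff₀' hc, ← hI n, ← intervalIntegral.integral_const_mul]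
  exact intervalIntegral.integral_mono_on hab
    (br_ii hab (continuousOn_const.mul ((hA n).norm.pow 2))) (br_ii hab (hG n)) (h n)

lemma br_sm_of {a b c : ℝ} (hab : a ≤ b) (hc : 0 < c) {A : ℕ → ℝ → ℂ} {G : ℕ → ℝ → ℝ}
    (hA : ∀ n, ContinuousOn (A n) (Icc a b)) (hG : ∀ n, ContinuousOn (G n) (Icc a b))
    (h : ∀ n, ∀ x ∈ Icc a b, c * ‖A n x‖ ^ 2 ≤ G n x)
    (hI : Tendsto (fun n => ∫ x in a..b, G n x) atTop (nhds 0)) :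
    BrSm a b A := by
  refine ⟨hA, ?_⟩
  have h1 := hI.const_mul c⁻¹
  rw [mul_zero] at h1
  refine squeeze_zero (fun n => br_int_nonneg hab _) (fun n => ?_) h1
  rw [inv_mul_eq_div, le_div_iff₀' hc, ← intervalIntegral.integral_const_mul]
  exact intervalIntegral.integral_mono_on hab
    (br_ii hab (continuousOn_const.mul ((hA n).norm.pow 2))) (br_ii hab (hG n)) (h n)

/-- small derivative (modulo a rotation) and zero initial value imply small -/
lemma br_prim {L μ : ℝ} (hL : 0 < L) {f h : ℕ → ℝ → ℂ}
    (hf : ∀ n, ContinuousOn (f n) (Icc 0 L))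
    (hd : ∀ n, ∀ x ∈ Ioo 0 L, HasDerivAt (f n) (h n x + Complex.I * (μ : ℂ) * f n x) x)
    (h0 : ∀ n, f n 0 = 0) (hh : BrSm 0 L h) : BrSm 0 L f := by
  refine ⟨hf, ?_⟩
  have hone : BrBd 0 L (fun _ _ => (1 : ℂ)) :=
    ⟨fun _ => continuousOn_const, L, fun n => by simp⟩
  have h1 := hh.int_mul hL.le hone
  simp only [norm_one, mul_one] at h1
  have key : ∀ n, ∀ x ∈ Icc 0 L, ‖f n x‖ ≤ ∫ y in (0 : ℝ)..L, ‖h n y‖ := by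
    intro n x hx
    set e : ℝ → ℂ := fun y => Complex.exp (((-μ * y : ℝ) : ℂ) * Complex.I) with he
    have hen : ∀ y, ‖e y‖ = 1 := fun y => Complex.norm_exp_ofReal_mul_I _
    have hec : Continuous e := by rw [he]; fun_prop
    have hed : ∀ y, HasDerivAt e (e y * (-(Complex.I * μ))) y := by
      intro y
      have h2 : HasDerivAt (fun y : ℝ => -μ * y) (-μ) y := by
        simpa using (hasDerivAt_id y).const_mul (-μ)
      have h3 := (h2.ofReal_comp.mul_const Complex.I).cexp
      refine h3.congr_deriv ?_
      simp only [he]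
      push_cast
      ring
    have hsub : Icc 0 x ⊆ Icc 0 L := Icc_subset_Icc le_rfl hx.2
    have hi := intervalIntegral.integral_eq_sub_of_hasDerivAt_of_le (a := 0) (b := x)
      (f := fun y => e y * f n y) (f' := fun y => e y * h n y) hx.1
      (hec.continuousOn.mul ((hf n).mono hsub))
      (fun y hy => ((hed y).mul (hd n y ⟨hy.1, hy.2.trans_le hx.2⟩)).congr_deriv (by ring))
      (br_ii hx.1 (hec.continuousOn.mul ((hh.1 n).mono hsub)))
    simp only [h0, mul_zero, sub_zero] at hi
    have h4 : ‖f n x‖ = ‖e x * f n x‖ := by rw [norm_mul, hen, one_mul]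
    rw [h4, ← hi]
    refine (intervalIntegral.norm_integral_le_integral_norm hx.1).trans ?_
    simp only [norm_mul, hen, one_mul]
    apply intervalIntegral.integral_mono_interval le_rfl hx.1 hx.2
    · filter_upwards with y
      positivity
    · exact br_ii hL.le (hh.1 n).norm
  have h2 := (h1.pow 2).const_mul L
  simp only [ne_eq, OfNat.ofNat_ne_zero, not_false_eq_true, zero_pow, mul_zero] at h2
  refine squeeze_zero (fun n => br_int_nonneg hL.le _) (fun n => ?_) h2
  have h3 : ∫ x in (0 : ℝ)..L, ‖f n x‖ ^ 2 ≤
      ∫ x in (0 : ℝ)..L, (∫ y in (0 : ℝ)..L, ‖h n y‖) ^ 2 := by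
    apply intervalIntegral.integral_mono_on hL.le (br_ii hL.le ((hf n).norm.pow 2))
      (br_ii hL.le continuousOn_const)
    intro x hx
    exact pow_le_pow_left₀ (norm_nonneg _) (key n x hx) 2
  refine h3.trans (le_of_eq ?_)
  rw [intervalIntegral.integral_const]
  simp

lemma br_c2 {f : ℝ → ℂ} {p q : ℝ} (h : ContDiffOn ℝ 2 f (Icc p q)) :
    (∀ x ∈ Ioo p q, HasDerivAt f (deriv f x) x) ∧
    (∀ x ∈ Ioo p q, HasDerivAt (deriv f) (deriv (deriv f) x) x) ∧
    ContinuousOn (deriv (deriv f)) (Ioo p q) := by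
  have h1 : ContDiffOn ℝ (1 + 1) f (Ioo p q) := by
    have := h.mono Ioo_subset_Icc_self
    rwa [one_add_one_eq_two]
  have h2 := (contDiffOn_succ_iff_deriv_of_isOpen isOpen_Ioo).1 h1
  have h3 : ContDiffOn ℝ (0 + 1) (deriv f) (Ioo p q) := by
    rw [zero_add]; exact h2.2.2
  have h4 := (contDiffOn_succ_iff_deriv_of_isOpen isOpen_Ioo).1 h3
  exact ⟨fun x hx => (h2.1.differentiableAt (isOpen_Ioo.mem_nhds hx)).hasDerivAt,
    fun x hx => (h4.1.differentiableAt (isOpen_Ioo.mem_nhds hx)).hasDerivAt,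
    h4.2.2.continuousOn⟩

lemma br_c1 {f : ℝ → ℂ} {p q : ℝ} (h : ContDiffOn ℝ 1 f (Icc p q)) (x : ℝ) (hx : x ∈ Ioo p q) :
    HasDerivAt f (deriv f x) x :=
  (((h.differentiableOn one_ne_zero).mono Ioo_subset_Icc_self).differentiableAt
    (isOpen_Ioo.mem_nhds hx)).hasDerivAt

lemma br_dw {f : ℝ → ℂ} {p q x : ℝ} (hx : x ∈ Ioo p q) :
    derivWithin f (Icc p q) x = deriv f x :=
  derivWithin_of_mem_nhds (Icc_mem_nhds hx.1 hx.2)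

lemma br_dwc {f : ℝ → ℂ} {p q : ℝ} (hpq : p < q) (h : ContDiffOn ℝ 1 f (Icc p q)) :
    ContinuousOn (derivWithin f (Icc p q)) (Icc p q) :=
  h.continuousOn_derivWithin (uniqueDiffOn_Icc hpq) le_rfl

lemma br_congr_Ioo {a b : ℝ} (hab : a ≤ b) {F G : ℝ → ℝ} (h : ∀ x ∈ Ioo a b, F x = G x) :
    ∫ x in a..b, F x = ∫ x in a..b, G x := by
  rw [intervalIntegral.integral_of_le hab, intervalIntegral.integral_of_le hab,
    integral_Ioc_eq_integral_Ioo, integral_Ioc_eq_integral_Ioo]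
  exact setIntegral_congr_fun measurableSet_Ioo h

lemma br_algebra (ρ₁ ρ₂ k₁ k₂ k₃ l A lam m : ℝ)
    (T T1 P P1 R R1 v2 v4 v6 d2 d4 d6 FT f2 FP f4 FR f6 : ℂ)
    (h2 : Complex.I * (lam : ℂ) * (ρ₁ : ℂ) * v2 - (k₁ : ℂ) * T1 - (l : ℂ) * (k₃ : ℂ) * R
      = (ρ₁ : ℂ) * (m : ℂ) * f2)
    (h4 : Complex.I * (lam : ℂ) * (ρ₂ : ℂ) * v4 - (k₂ : ℂ) * P1 + (k₁ : ℂ) * T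
      = (ρ₂ : ℂ) * (m : ℂ) * f4)
    (h6 : Complex.I * (lam : ℂ) * (ρ₁ : ℂ) * v6 - (k₃ : ℂ) * R1 + (l : ℂ) * (k₁ : ℂ) * T
      + (A : ℂ) * v6 = (ρ₁ : ℂ) * (m : ℂ) * f6)
    (hT : Complex.I * (lam : ℂ) * T - (d2 + v4 + (l : ℂ) * v6) = (m : ℂ) * FT)
    (hP : Complex.I * (lam : ℂ) * P - d4 = (m : ℂ) * FP)
    (hR : Complex.I * (lam : ℂ) * R - (d6 - (l : ℂ) * v2) = (m : ℂ) * FR) :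
    (k₁ : ℂ) * (T1 * star v2 + T * star d2 + (star T1 * v2 + star T * d2))
      + (k₂ : ℂ) * (P1 * star v4 + P * star d4 + (star P1 * v4 + star P * d4))
      + (k₃ : ℂ) * (R1 * star v6 + R * star d6 + (star R1 * v6 + star R * d6))
    = 2 * (A : ℂ) * (v6 * star v6) - (m : ℂ) *
      ((k₁ : ℂ) * (FT * star T) + (k₁ : ℂ) * (T * star FT)
      + ((ρ₁ : ℂ) * (f2 * star v2) + (ρ₁ : ℂ) * (v2 * star f2))
      + ((k₂ : ℂ) * (FP * star P) + (k₂ : ℂ) * (P * star FP))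
      + ((ρ₂ : ℂ) * (f4 * star v4) + (ρ₂ : ℂ) * (v4 * star f4))
      + ((k₃ : ℂ) * (FR * star R) + (k₃ : ℂ) * (R * star FR))
      + ((ρ₁ : ℂ) * (f6 * star v6) + (ρ₁ : ℂ) * (v6 * star f6))) := by
  have c2 := congrArg (starRingEnd ℂ) h2
  have c4 := congrArg (starRingEnd ℂ) h4
  have c6 := congrArg (starRingEnd ℂ) h6
  have cT := congrArg (starRingEnd ℂ) hT
  have cP := congrArg (starRingEnd ℂ) hP
  have cR := congrArg (starRingEnd ℂ) hR
  simp only [map_mul, map_add, map_sub, Complex.conj_ofReal, Complex.conj_I] at c2 c4 c6 cT cP cR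
  simp only [starRingEnd_apply] at c2 c4 c6 cT cP cR
  linear_combination -(star v2 * h2 + v2 * c2 + star v4 * h4 + v4 * c4 + star v6 * h6 + v6 * c6
    + (k₁ : ℂ) * (star T * hT + T * cT) + (k₂ : ℂ) * (star P * hP + P * cP)
    + (k₃ : ℂ) * (star R * hR + R * cR))

section glob

variable {ρ₁ ρ₂ k₁ k₂ k₃ l L β a₀ : ℝ} {ℓ : ℕ}

/-- shear force, continuous up to the boundary -/
def brT (S : BresseSetting ρ₁ ρ₂ k₁ k₂ k₃ l L β a₀ ℓ) (n : ℕ) (x : ℝ) : ℂ :=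
  derivWithin (S.v1 n) (Icc 0 L) x + S.v3 n x + (l : ℂ) * S.v5 n x
/-- bending moment -/
def brP (S : BresseSetting ρ₁ ρ₂ k₁ k₂ k₃ l L β a₀ ℓ) (n : ℕ) (x : ℝ) : ℂ :=
  derivWithin (S.v3 n) (Icc 0 L) x
/-- axial force -/
def brR (S : BresseSetting ρ₁ ρ₂ k₁ k₂ k₃ l L β a₀ ℓ) (n : ℕ) (x : ℝ) : ℂ :=
  derivWithin (S.v5 n) (Icc 0 L) x - (l : ℂ) * S.v1 n x
/-- shear force of the data -/
def brFT (S : BresseSetting ρ₁ ρ₂ k₁ k₂ k₃ l L β a₀ ℓ) (n : ℕ) (x : ℝ) : ℂ :=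
  derivWithin (S.f1 n) (Icc 0 L) x + S.f3 n x + (l : ℂ) * S.f5 n x
/-- bending moment of the data -/
def brFP (S : BresseSetting ρ₁ ρ₂ k₁ k₂ k₃ l L β a₀ ℓ) (n : ℕ) (x : ℝ) : ℂ :=
  derivWithin (S.f3 n) (Icc 0 L) x
/-- axial force of the data -/
def brFR (S : BresseSetting ρ₁ ρ₂ k₁ k₂ k₃ l L β a₀ ℓ) (n : ℕ) (x : ℝ) : ℂ :=
  derivWithin (S.f5 n) (Icc 0 L) x - (l : ℂ) * S.f1 n x

lemma brT_cont (S : BresseSetting ρ₁ ρ₂ k₁ k₂ k₃ l L β a₀ ℓ) (hL : 0 < L) (n : ℕ) :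
    ContinuousOn (brT S n) (Icc 0 L) :=
  ((br_dwc hL ((S.reg_v1 n).of_le one_le_two)).add (S.reg_v3 n).continuousOn).add
    (continuousOn_const.mul (S.reg_v5 n).continuousOn)
lemma brP_cont (S : BresseSetting ρ₁ ρ₂ k₁ k₂ k₃ l L β a₀ ℓ) (hL : 0 < L) (n : ℕ) :
    ContinuousOn (brP S n) (Icc 0 L) :=
  br_dwc hL ((S.reg_v3 n).of_le one_le_two)
lemma brR_cont (S : BresseSetting ρ₁ ρ₂ k₁ k₂ k₃ l L β a₀ ℓ) (hL : 0 < L) (n : ℕ) :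
    ContinuousOn (brR S n) (Icc 0 L) :=
  (br_dwc hL (S.reg_v5 n)).sub (continuousOn_const.mul (S.reg_v1 n).continuousOn)
lemma brFT_cont (S : BresseSetting ρ₁ ρ₂ k₁ k₂ k₃ l L β a₀ ℓ) (hL : 0 < L) (n : ℕ) :
    ContinuousOn (brFT S n) (Icc 0 L) :=
  ((br_dwc hL (S.reg_f1 n)).add (S.reg_f3 n).continuousOn).add
    (continuousOn_const.mul (S.reg_f5 n).continuousOn)
lemma brFP_cont (S : BresseSetting ρ₁ ρ₂ k₁ k₂ k₃ l L β a₀ ℓ) (hL : 0 < L) (n : ℕ) :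
    ContinuousOn (brFP S n) (Icc 0 L) :=
  br_dwc hL (S.reg_f3 n)
lemma brFR_cont (S : BresseSetting ρ₁ ρ₂ k₁ k₂ k₃ l L β a₀ ℓ) (hL : 0 < L) (n : ℕ) :
    ContinuousOn (brFR S n) (Icc 0 L) :=
  (br_dwc hL (S.reg_f5 n)).sub (continuousOn_const.mul (S.reg_f1 n).continuousOn)

lemma br_boundsU (S : BresseSetting ρ₁ ρ₂ k₁ k₂ k₃ l L β a₀ ℓ) (hL : 0 < L)
    (hr1 : 0 < ρ₁) (hr2 : 0 < ρ₂) (hk1 : 0 < k₁) (hk2 : 0 < k₂) (hk3 : 0 < k₃) :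
    BrBd 0 L (brT S) ∧ BrBd 0 L S.v2 ∧ BrBd 0 L (brP S) ∧ BrBd 0 L S.v4 ∧ BrBd 0 L (brR S) ∧
      BrBd 0 L S.v6 := by
  have cT := brT_cont S hL
  have cP := brP_cont S hL
  have cR := brR_cont S hL
  have c2 := fun n => (S.reg_v2 n).continuousOn
  have c4 := fun n => (S.reg_v4 n).continuousOn
  have c6 := fun n => (S.reg_v6 n).continuousOn
  set G : ℕ → ℝ → ℝ := fun n x => k₁ * ‖brT S n x‖ ^ 2 + ρ₁ * ‖S.v2 n x‖ ^ 2
        + k₂ * ‖brP S n x‖ ^ 2 + ρ₂ * ‖S.v4 n x‖ ^ 2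
        + k₃ * ‖brR S n x‖ ^ 2 + ρ₁ * ‖S.v6 n x‖ ^ 2 with hG
  have cG : ∀ n, ContinuousOn (G n) (Icc 0 L) := fun n =>
    (((((continuousOn_const.mul ((cT n).norm.pow 2)).add
      (continuousOn_const.mul ((c2 n).norm.pow 2))).add
      (continuousOn_const.mul ((cP n).norm.pow 2))).add
      (continuousOn_const.mul ((c4 n).norm.pow 2))).add
      (continuousOn_const.mul ((cR n).norm.pow 2))).add
      (continuousOn_const.mul ((c6 n).norm.pow 2))
  have hI : ∀ n, ∫ x in (0 : ℝ)..L, G n x = 1 := by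
    intro n
    rw [← S.normU n]
    apply br_congr_Ioo hL.le
    intro x hx
    simp only [hG, brT, brP, brR, br_dw hx]
  have hpos : ∀ n x, 0 ≤ k₁ * ‖brT S n x‖ ^ 2 ∧ 0 ≤ ρ₁ * ‖S.v2 n x‖ ^ 2
        ∧ 0 ≤ k₂ * ‖brP S n x‖ ^ 2 ∧ 0 ≤ ρ₂ * ‖S.v4 n x‖ ^ 2
        ∧ 0 ≤ k₃ * ‖brR S n x‖ ^ 2 ∧ 0 ≤ ρ₁ * ‖S.v6 n x‖ ^ 2 := fun n x =>
    ⟨by positivity, by positivity, by positivity, by positivity, by positivity, by positivity⟩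
  refine ⟨br_bd_of hL.le hk1 cT cG ?_ hI, br_bd_of hL.le hr1 c2 cG ?_ hI,
    br_bd_of hL.le hk2 cP cG ?_ hI, br_bd_of hL.le hr2 c4 cG ?_ hI,
    br_bd_of hL.le hk3 cR cG ?_ hI, br_bd_of hL.le hr1 c6 cG ?_ hI⟩ <;>
  · intro n x _
    obtain ⟨q1, q2, q3, q4, q5, q6⟩ := hpos n x
    simp only [hG]
    linarith

lemma br_boundsF (S : BresseSetting ρ₁ ρ₂ k₁ k₂ k₃ l L β a₀ ℓ) (hL : 0 < L)
    (hr1 : 0 < ρ₁) (hr2 : 0 < ρ₂) (hk1 : 0 < k₁) (hk2 : 0 < k₂) (hk3 : 0 < k₃) :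
    BrSm 0 L (brFT S) ∧ BrSm 0 L S.f2 ∧ BrSm 0 L (brFP S) ∧ BrSm 0 L S.f4 ∧ BrSm 0 L (brFR S) ∧
      BrSm 0 L S.f6 := by
  have cT := brFT_cont S hL
  have cP := brFP_cont S hL
  have cR := brFR_cont S hL
  have c2 := S.reg_f2
  have c4 := S.reg_f4
  have c6 := S.reg_f6
  set G : ℕ → ℝ → ℝ := fun n x => k₁ * ‖brFT S n x‖ ^ 2 + ρ₁ * ‖S.f2 n x‖ ^ 2
        + k₂ * ‖brFP S n x‖ ^ 2 + ρ₂ * ‖S.f4 n x‖ ^ 2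
        + k₃ * ‖brFR S n x‖ ^ 2 + ρ₁ * ‖S.f6 n x‖ ^ 2 with hG
  have cG : ∀ n, ContinuousOn (G n) (Icc 0 L) := fun n =>
    (((((continuousOn_const.mul ((cT n).norm.pow 2)).add
      (continuousOn_const.mul ((c2 n).norm.pow 2))).add
      (continuousOn_const.mul ((cP n).norm.pow 2))).add
      (continuousOn_const.mul ((c4 n).norm.pow 2))).add
      (continuousOn_const.mul ((cR n).norm.pow 2))).add
      (continuousOn_const.mul ((c6 n).norm.pow 2))
  have hI : Tendsto (fun n => ∫ x in (0 : ℝ)..L, G n x) atTop (nhds 0) := by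
    refine S.normF.congr fun n => ?_
    apply br_congr_Ioo hL.le
    intro x hx
    simp only [hG, brFT, brFP, brFR, br_dw hx]
  have hpos : ∀ n x, 0 ≤ k₁ * ‖brFT S n x‖ ^ 2 ∧ 0 ≤ ρ₁ * ‖S.f2 n x‖ ^ 2
        ∧ 0 ≤ k₂ * ‖brFP S n x‖ ^ 2 ∧ 0 ≤ ρ₂ * ‖S.f4 n x‖ ^ 2
        ∧ 0 ≤ k₃ * ‖brFR S n x‖ ^ 2 ∧ 0 ≤ ρ₁ * ‖S.f6 n x‖ ^ 2 := fun n x =>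
    ⟨by positivity, by positivity, by positivity, by positivity, by positivity, by positivity⟩
  refine ⟨br_sm_of hL.le hk1 cT cG ?_ hI, br_sm_of hL.le hr1 c2 cG ?_ hI,
    br_sm_of hL.le hk2 cP cG ?_ hI, br_sm_of hL.le hr2 c4 cG ?_ hI,
    br_sm_of hL.le hk3 cR cG ?_ hI, br_sm_of hL.le hr1 c6 cG ?_ hI⟩ <;>
  · intro n x _
    obtain ⟨q1, q2, q3, q4, q5, q6⟩ := hpos n x
    simp only [hG]
    linarith

lemma br_smallF (S : BresseSetting ρ₁ ρ₂ k₁ k₂ k₃ l L β a₀ ℓ) (hL : 0 < L)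
    (hr1 : 0 < ρ₁) (hr2 : 0 < ρ₂) (hk1 : 0 < k₁) (hk2 : 0 < k₂) (hk3 : 0 < k₃) :
    BrSm 0 L S.f1 ∧ BrSm 0 L S.f3 ∧ BrSm 0 L S.f5 := by
  obtain ⟨sT, -, sP, -, sR, -⟩ := br_boundsF S hL hr1 hr2 hk1 hk2 hk3
  have s3 : BrSm 0 L S.f3 := by
    refine br_prim (μ := 0) hL (fun n => (S.reg_f3 n).continuousOn) (h := brFP S) ?_
      (fun n => (S.bc_zero n).2.2.2.2.2.2.2.1) sP
    intro n x hx
    refine (br_c1 (S.reg_f3 n) x hx).congr_deriv ?_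
    simp [brFP, br_dw hx]
  have sH1 : BrSm 0 L (fun n x => brFT S n x + (-1) * S.f3 n x) := sT.add hL.le (s3.smul _)
  have sz1 : BrSm 0 L (fun n x => S.f1 n x + Complex.I * S.f5 n x) := by
    refine br_prim (μ := l) hL
      (fun n => (S.reg_f1 n).continuousOn.add (continuousOn_const.mul (S.reg_f5 n).continuousOn))
      ?_ (fun n => ?_) (sH1.add hL.le (sR.smul Complex.I))
    · intro n x hx
      refine ((br_c1 (S.reg_f1 n) x hx).add
        ((br_c1 (S.reg_f5 n) x hx).const_mul Complex.I)).congr_deriv ?_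
      simp only [brFT, brFR, br_dw hx]
      linear_combination (-(l : ℂ) * S.f5 n x) * Complex.I_sq
    · have h := S.bc_zero n
      simp [h.2.2.2.2.2.2.1, h.2.2.2.2.2.2.2.2]
  have sz2 : BrSm 0 L (fun n x => S.f1 n x + (-Complex.I) * S.f5 n x) := by
    refine br_prim (μ := -l) hL
      (fun n => (S.reg_f1 n).continuousOn.add (continuousOn_const.mul (S.reg_f5 n).continuousOn))
      ?_ (fun n => ?_) (sH1.add hL.le (sR.smul (-Complex.I)))
    · intro n x hx
      refine ((br_c1 (S.reg_f1 n) x hx).add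
        ((br_c1 (S.reg_f5 n) x hx).const_mul (-Complex.I))).congr_deriv ?_
      simp only [brFT, brFR, br_dw hx]
      push_cast
      linear_combination (-(l : ℂ) * S.f5 n x) * Complex.I_sq
    · have h := S.bc_zero n
      simp [h.2.2.2.2.2.2.1, h.2.2.2.2.2.2.2.2]
  refine ⟨?_, s3, ?_⟩
  · refine ((sz1.add hL.le sz2).smul (1 / 2)).congr hL.le fun n x _ => ?_
    ring
  · refine ((sz1.add hL.le (sz2.smul (-1))).smul (-Complex.I / 2)).congr hL.le fun n x _ => ?_
    linear_combination (S.f5 n x) * Complex.I_sq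

/-- the boundary flux -/
def brE (S : BresseSetting ρ₁ ρ₂ k₁ k₂ k₃ l L β a₀ ℓ) (n : ℕ) (x : ℝ) : ℂ :=
  (k₁ : ℂ) * (brT S n x * star (S.v2 n x) + star (brT S n x) * S.v2 n x)
  + (k₂ : ℂ) * (brP S n x * star (S.v4 n x) + star (brP S n x) * S.v4 n x)
  + (k₃ : ℂ) * (brR S n x * star (S.v6 n x) + star (brR S n x) * S.v6 n x)

/-- the pairing of data and solution -/
def brW (S : BresseSetting ρ₁ ρ₂ k₁ k₂ k₃ l L β a₀ ℓ) (n : ℕ) (x : ℝ) : ℂ :=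
  (k₁ : ℂ) * (brFT S n x * star (brT S n x)) + (k₁ : ℂ) * (brT S n x * star (brFT S n x))
      + ((ρ₁ : ℂ) * (S.f2 n x * star (S.v2 n x)) + (ρ₁ : ℂ) * (S.v2 n x * star (S.f2 n x)))
      + ((k₂ : ℂ) * (brFP S n x * star (brP S n x)) + (k₂ : ℂ) * (brP S n x * star (brFP S n x)))
      + ((ρ₂ : ℂ) * (S.f4 n x * star (S.v4 n x)) + (ρ₂ : ℂ) * (S.v4 n x * star (S.f4 n x)))
      + ((k₃ : ℂ) * (brFR S n x * star (brR S n x)) + (k₃ : ℂ) * (brR S n x * star (brFR S n x)))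
      + ((ρ₁ : ℂ) * (S.f6 n x * star (S.v6 n x)) + (ρ₁ : ℂ) * (S.v6 n x * star (S.f6 n x)))

lemma br_energy_deriv (S : BresseSetting ρ₁ ρ₂ k₁ k₂ k₃ l L β a₀ ℓ) {p q A : ℝ}
    (hpq : Ioo p q ⊆ Ioo 0 β ∪ Ioo β L) (hpq0 : Ioo p q ⊆ Ioo 0 L)
    (h5 : ∀ n, ContDiffOn ℝ 2 (S.v5 n) (Icc p q))
    (hA : ∀ x ∈ Ioo p q, (if x < β then (a₀ : ℂ) else 0) = (A : ℂ)) (n : ℕ) (x : ℝ)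
    (hx : x ∈ Ioo p q) :
    HasDerivAt (brE S n) (2 * (A : ℂ) * (S.v6 n x * star (S.v6 n x))
      - (((S.lam n) ^ (-(ℓ : ℤ)) : ℝ) : ℂ) * brW S n x) x := by
  have hx0 := hpq0 hx
  have hnh : Ioo p q ∈ nhds x := isOpen_Ioo.mem_nhds hx
  have hm : (((S.lam n) ^ (-(ℓ : ℤ)) : ℝ) : ℂ) = (S.lam n : ℂ) ^ (-(ℓ : ℤ)) :=
    Complex.ofReal_zpow _ _
  have w1 := br_c2 (S.reg_v1 n)
  have w3 := br_c2 (S.reg_v3 n)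
  have w5 := br_c2 (h5 n)
  -- derivatives of the forces
  have dT : HasDerivAt (brT S n)
      (deriv (fun y => deriv (S.v1 n) y + S.v3 n y + (l : ℂ) * S.v5 n y) x) x := by
    have h := (((w1.2.1 x hx0).add (w3.1 x hx0)).add ((w5.1 x hx).const_mul (l : ℂ)))
    have h' : HasDerivAt (fun y => deriv (S.v1 n) y + S.v3 n y + (l : ℂ) * S.v5 n y) _ x := h
    refine h'.differentiableAt.hasDerivAt.congr_of_eventuallyEq ?_
    filter_upwards [hnh] with y hy
    simp only [brT, br_dw (hpq0 hy)]
  have dR : HasDerivAt (brR S n)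
      (deriv (fun y => deriv (S.v5 n) y - (l : ℂ) * S.v1 n y) x) x := by
    have h := ((w5.2.1 x hx).sub ((w1.1 x hx0).const_mul (l : ℂ)))
    have h' : HasDerivAt (fun y => deriv (S.v5 n) y - (l : ℂ) * S.v1 n y) _ x := h
    refine h'.differentiableAt.hasDerivAt.congr_of_eventuallyEq ?_
    filter_upwards [hnh] with y hy
    simp only [brR, br_dw (hpq0 hy)]
  have dP : HasDerivAt (brP S n) (deriv (deriv (S.v3 n)) x) x := by
    refine (w3.2.1 x hx0).congr_of_eventuallyEq ?_
    filter_upwards [hnh] with y hy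
    simp only [brP, br_dw (hpq0 hy)]
  have d2 : HasDerivAt (S.v2 n) (Complex.I * (S.lam n : ℂ) * deriv (S.v1 n) x
      - (S.lam n : ℂ) ^ (-(ℓ : ℤ)) * deriv (S.f1 n) x) x := by
    refine (((w1.1 x hx0).const_mul (Complex.I * (S.lam n : ℂ))).sub
      ((br_c1 (S.reg_f1 n) x hx0).const_mul ((S.lam n : ℂ) ^ (-(ℓ : ℤ))))).congr_of_eventuallyEq ?_
    filter_upwards [hnh] with y hy
    simp only [Pi.sub_apply]
    linear_combination -(S.eq1 n y (hpq hy))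
  have d4 : HasDerivAt (S.v4 n) (Complex.I * (S.lam n : ℂ) * deriv (S.v3 n) x
      - (S.lam n : ℂ) ^ (-(ℓ : ℤ)) * deriv (S.f3 n) x) x := by
    refine (((w3.1 x hx0).const_mul (Complex.I * (S.lam n : ℂ))).sub
      ((br_c1 (S.reg_f3 n) x hx0).const_mul ((S.lam n : ℂ) ^ (-(ℓ : ℤ))))).congr_of_eventuallyEq ?_
    filter_upwards [hnh] with y hy
    simp only [Pi.sub_apply]
    linear_combination -(S.eq3 n y (hpq hy))
  have d6 : HasDerivAt (S.v6 n) (Complex.I * (S.lam n : ℂ) * deriv (S.v5 n) x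
      - (S.lam n : ℂ) ^ (-(ℓ : ℤ)) * deriv (S.f5 n) x) x := by
    refine (((w5.1 x hx).const_mul (Complex.I * (S.lam n : ℂ))).sub
      ((br_c1 (S.reg_f5 n) x hx0).const_mul ((S.lam n : ℂ) ^ (-(ℓ : ℤ))))).congr_of_eventuallyEq ?_
    filter_upwards [hnh] with y hy
    simp only [Pi.sub_apply]
    linear_combination -(S.eq5 n y (hpq hy))
  have dE := ((((dT.mul d2.star).add (dT.star.mul d2)).const_mul (k₁ : ℂ)).add
    (((dP.mul d4.star).add (dP.star.mul d4)).const_mul (k₂ : ℂ))).add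
    (((dR.mul d6.star).add (dR.star.mul d6)).const_mul (k₃ : ℂ))
  refine HasDerivAt.congr_deriv (f := brE S n) dE ?_
  have e1 := S.eq1 n x (hpq hx)
  have e2 := S.eq2 n x (hpq hx)
  have e3 := S.eq3 n x (hpq hx)
  have e4 := S.eq4 n x (hpq hx)
  have e5 := S.eq5 n x (hpq hx)
  have e6 := S.eq6 n x (hpq hx)
  rw [hA x hx] at e6
  rw [← hm] at e1 e2 e3 e4 e5 e6 ⊢
  have key := br_algebra ρ₁ ρ₂ k₁ k₂ k₃ l A (S.lam n) ((S.lam n) ^ (-(ℓ : ℤ)))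
    (brT S n x) (deriv (fun y => deriv (S.v1 n) y + S.v3 n y + (l : ℂ) * S.v5 n y) x)
    (brP S n x) (deriv (deriv (S.v3 n)) x)
    (brR S n x) (deriv (fun y => deriv (S.v5 n) y - (l : ℂ) * S.v1 n y) x)
    (S.v2 n x) (S.v4 n x) (S.v6 n x)
    (brFT S n x) (S.f2 n x) (brFP S n x) (S.f4 n x) (brFR S n x) (S.f6 n x)
    (by simp only [brR, br_dw hx0]; exact e2) (by simp only [brT, br_dw hx0]; exact e4)
    (by simp only [brT, br_dw hx0]; exact e6)
    (d2 := Complex.I * (S.lam n : ℂ) * deriv (S.v1 n) x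
      - (((S.lam n) ^ (-(ℓ : ℤ)) : ℝ) : ℂ) * deriv (S.f1 n) x)
    (d4 := Complex.I * (S.lam n : ℂ) * deriv (S.v3 n) x
      - (((S.lam n) ^ (-(ℓ : ℤ)) : ℝ) : ℂ) * deriv (S.f3 n) x)
    (d6 := Complex.I * (S.lam n : ℂ) * deriv (S.v5 n) x
      - (((S.lam n) ^ (-(ℓ : ℤ)) : ℝ) : ℂ) * deriv (S.f5 n) x)
    (by
      simp only [brT, brFT, br_dw hx0]
      linear_combination e3 + (l : ℂ) * e5)
    (by
      simp only [brP, brFP, br_dw hx0]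
      ring)
    (by
      simp only [brR, brFR, br_dw hx0]
      linear_combination -(l : ℂ) * e1)
  unfold brW
  rw [← key]

end glob

section fin

variable {ρ₁ ρ₂ k₁ k₂ k₃ l L β a₀ : ℝ}

lemma brE_cont {ℓ : ℕ} (S : BresseSetting ρ₁ ρ₂ k₁ k₂ k₃ l L β a₀ ℓ) (hL : 0 < L) (n : ℕ) :
    ContinuousOn (brE S n) (Icc 0 L) := by
  have cT := brT_cont S hL n
  have cP := brP_cont S hL n
  have cR := brR_cont S hL n
  have c2 := (S.reg_v2 n).continuousOn
  have c4 := (S.reg_v4 n).continuousOn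
  have c6 := (S.reg_v6 n).continuousOn
  exact ((continuousOn_const.mul ((cT.mul c2.star).add (cT.star.mul c2))).add
    (continuousOn_const.mul ((cP.mul c4.star).add (cP.star.mul c4)))).add
    (continuousOn_const.mul ((cR.mul c6.star).add (cR.star.mul c6)))

lemma brW_z {ℓ : ℕ} (S : BresseSetting ρ₁ ρ₂ k₁ k₂ k₃ l L β a₀ ℓ) (hL : 0 < L)
    (hr1 : 0 < ρ₁) (hr2 : 0 < ρ₂) (hk1 : 0 < k₁) (hk2 : 0 < k₂) (hk3 : 0 < k₃) :
    BrZ 0 L (brW S) := by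
  obtain ⟨bT, b2, bP, b4, bR, b6⟩ := br_boundsU S hL hr1 hr2 hk1 hk2 hk3
  obtain ⟨sT, s2, sP, s4, sR, s6⟩ := br_boundsF S hL hr1 hr2 hk1 hk2 hk3
  have h0 := hL.le
  have key : ∀ (c : ℝ) {g h : ℕ → ℝ → ℂ}, BrSm 0 L g → BrBd 0 L h →
      BrZ 0 L (fun n x => (c : ℂ) * (g n x * (starRingEnd ℂ) (h n x))
        + (c : ℂ) * (h n x * (starRingEnd ℂ) (g n x))) := fun c g h hg hh =>
    (hg.mul h0 (fun _ => (c : ℂ)) continuous_const hh).add h0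
      (hg.mul_left h0 (fun _ => (c : ℂ)) continuous_const hh)
  exact (((((key k₁ sT bT).add h0 (key ρ₁ s2 b2)).add h0 (key k₂ sP bP)).add h0
    (key ρ₂ s4 b4)).add h0 (key k₃ sR bR)).add h0 (key ρ₁ s6 b6)

lemma br_dissip (S : BresseSetting ρ₁ ρ₂ k₁ k₂ k₃ l L β a₀ 2) (hL : 0 < L)
    (hr1 : 0 < ρ₁) (hr2 : 0 < ρ₂) (hk1 : 0 < k₁) (hk2 : 0 < k₂) (hk3 : 0 < k₃)
    (ha : 0 < a₀) (hβ : 0 < β) (hβL : β < L) :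
    BrSm 0 β (fun n x => (S.lam n : ℂ) * S.v6 n x) := by
  have hz := brW_z S hL hr1 hr2 hk1 hk2 hk3
  have hs1 : Icc 0 β ⊆ Icc 0 L := Icc_subset_Icc le_rfl hβL.le
  have hs2 : Icc β L ⊆ Icc 0 L := Icc_subset_Icc hβ.le le_rfl
  have c6 : ∀ n, ContinuousOn (S.v6 n) (Icc 0 L) := fun n => (S.reg_v6 n).continuousOn
  have cv : ∀ n, ContinuousOn (fun x => S.v6 n x * star (S.v6 n x)) (Icc 0 L) :=
    fun n => (c6 n).mul (c6 n).star
  have id1 : ∀ n, 2 * (a₀ : ℂ) * (∫ x in (0 : ℝ)..β, S.v6 n x * star (S.v6 n x))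
      = (((S.lam n) ^ (-((2 : ℕ) : ℤ)) : ℝ) : ℂ) * ∫ x in (0 : ℝ)..L, brW S n x := by
    intro n
    set m : ℂ := (((S.lam n) ^ (-((2 : ℕ) : ℤ)) : ℝ) : ℂ) with hm
    have iA : IntervalIntegrable (fun x => 2 * (a₀ : ℂ) * (S.v6 n x * star (S.v6 n x)))
        volume 0 β := br_ii hβ.le (continuousOn_const.mul ((cv n).mono hs1))
    have iW1 : IntervalIntegrable (fun x => m * brW S n x) volume 0 β :=
      br_ii hβ.le (continuousOn_const.mul ((hz.1 n).mono hs1))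
    have iW2 : IntervalIntegrable (fun x => m * brW S n x) volume β L :=
      br_ii hβL.le (continuousOn_const.mul ((hz.1 n).mono hs2))
    have i1 := intervalIntegral.integral_eq_sub_of_hasDerivAt_of_le (a := 0) (b := β)
      (f := brE S n) hβ.le ((brE_cont S hL n).mono hs1)
      (br_energy_deriv S (p := 0) (q := β) (A := a₀) subset_union_left
        (Ioo_subset_Ioo le_rfl hβL.le) S.reg_v5_left (fun x hx => by simp [hx.2]) n)
      (iA.sub iW1)
    have i2 := intervalIntegral.integral_eq_sub_of_hasDerivAt_of_le (a := β) (b := L)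
      (f := brE S n) (f' := fun x => -(m * brW S n x)) hβL.le ((brE_cont S hL n).mono hs2)
      (fun x hx => (br_energy_deriv S (p := β) (q := L) (A := 0) subset_union_right
        (Ioo_subset_Ioo hβ.le le_rfl) S.reg_v5_right
        (fun x hx => by simp [not_lt.2 hx.1.le]) n x hx).congr_deriv (by simp [hm]))
      iW2.neg
    rw [← hm] at i1
    rw [intervalIntegral.integral_sub iA iW1] at i1
    rw [intervalIntegral.integral_neg] at i2
    have hE0 : brE S n 0 = 0 := by
      have h := S.bc_zero n
      simp [brE, h.2.1, h.2.2.2.1, h.2.2.2.2.2.1]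
    have hEL : brE S n L = 0 := by
      have h := S.bc_L n
      simp [brE, h.2.1, h.2.2.2.1, h.2.2.2.2.2.1]
    have hadd := intervalIntegral.integral_add_adjacent_intervals iW1 iW2
    rw [← intervalIntegral.integral_const_mul, ← intervalIntegral.integral_const_mul, ← hadd]
    rw [hE0] at i1
    rw [hEL] at i2
    linear_combination i1 + i2
  refine ⟨fun n => continuousOn_const.mul ((c6 n).mono hs1), ?_⟩
  have h1 := hz.2.const_mul ((2 * (a₀ : ℂ))⁻¹)
  rw [mul_zero] at h1
  have h2 := (Complex.continuous_re.tendsto 0).comp h1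
  rw [Complex.zero_re] at h2
  refine h2.congr fun n => ?_
  have ha' : (2 * (a₀ : ℂ)) ≠ 0 := by
    have : 2 * a₀ ≠ 0 := by positivity
    exact_mod_cast this
  have hl0 : (S.lam n : ℂ) ≠ 0 := by exact_mod_cast S.lam_ne n
  have e1 : (2 * (a₀ : ℂ))⁻¹ * (∫ x in (0 : ℝ)..L, brW S n x)
      = (S.lam n : ℂ) ^ 2 * ∫ x in (0 : ℝ)..β, S.v6 n x * star (S.v6 n x) := by
    have := id1 n
    rw [inv_mul_eq_iff_eq_mul₀ ha']
    rw [zpow_neg, zpow_natCast] at this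
    push_cast at this
    field_simp at this ⊢
    linear_combination -this
  have e2 : ((∫ x in (0 : ℝ)..β, ‖(S.lam n : ℂ) * S.v6 n x‖ ^ 2 : ℝ) : ℂ)
      = (S.lam n : ℂ) ^ 2 * ∫ x in (0 : ℝ)..β, S.v6 n x * star (S.v6 n x) := by
    rw [← intervalIntegral.integral_const_mul, ← intervalIntegral.integral_ofReal]
    apply intervalIntegral.integral_congr
    intro x _
    simp only
    rw [Complex.ofReal_pow, ← Complex.mul_conj', starRingEnd_apply, star_mul']
    have : star (S.lam n : ℂ) = S.lam n := Complex.conj_ofReal _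
    rw [this]
    ring
  simp only [Function.comp]
  rw [e1, ← e2, Complex.ofReal_re]

lemma br_main (S : BresseSetting ρ₁ ρ₂ k₁ k₂ k₃ l L β a₀ 2) (hL : 0 < L)
    (hr1 : 0 < ρ₁) (hr2 : 0 < ρ₂) (hk1 : 0 < k₁) (hk2 : 0 < k₂) (hk3 : 0 < k₃)
    (ha : 0 < a₀) (hβ : 0 < β) (hβL : β < L) (hl : 0 < l) (hkr : k₁ * ρ₂ = k₂ * ρ₁)
    {d : ℝ} (hd : 0 < d) (hdβ : d + 5 * d ≤ β - d - 5 * d) :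
    BrSm (d + 4 * d) (β - d - 4 * d) (fun n => deriv (S.v3 n)) ∧
      BrSm (d + 5 * d) (β - d - 5 * d) (fun n x => (S.lam n : ℂ) * S.v3 n x) := by
  have hl0 : ∀ n, (S.lam n : ℂ) ≠ 0 := fun n => by exact_mod_cast S.lam_ne n
  have hinv : Tendsto (fun n => ((S.lam n : ℂ))⁻¹) atTop (nhds 0) := by
    rw [tendsto_zero_iff_norm_tendsto_zero]
    refine (tendsto_inv_atTop_zero.comp S.lam_tendsto).congr fun n => ?_
    simp
  have hm : ∀ n, (S.lam n : ℂ) ^ (-((2 : ℕ) : ℤ)) = (S.lam n : ℂ)⁻¹ * (S.lam n : ℂ)⁻¹ := by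
    intro n
    rw [zpow_neg, zpow_natCast, pow_two, mul_inv]
  have hinv2 : Tendsto (fun n => (S.lam n : ℂ)⁻¹ * (S.lam n : ℂ)⁻¹) atTop (nhds 0) := by
    simpa using hinv.mul hinv
  have hd0 : (0 : ℝ) ≤ d := hd.le
  have hab : d ≤ β - d := by linarith
  have hb : β - d ≤ L := by linarith
  have hb' : β - d ≤ β := by linarith
  obtain ⟨bT, b2, bP, b4, bR, b6⟩ := br_boundsU S hL hr1 hr2 hk1 hk2 hk3
  obtain ⟨-, s2, -, s4, -, s6⟩ := br_boundsF S hL hr1 hr2 hk1 hk2 hk3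
  obtain ⟨s1, s3, s5⟩ := br_smallF S hL hr1 hr2 hk1 hk2 hk3
  have sv6 := (br_dissip S hL hr1 hr2 hk1 hk2 hk3 ha hβ hβL).mono hd0 hab hb'
  replace bT := bT.mono hd0 hab hb
  replace b2 := b2.mono hd0 hab hb
  replace bP := bP.mono hd0 hab hb
  replace b4 := b4.mono hd0 hab hb
  replace bR := bR.mono hd0 hab hb
  replace b6 := b6.mono hd0 hab hb
  replace s1 := s1.mono hd0 hab hb
  replace s2 := s2.mono hd0 hab hb
  replace s3 := s3.mono hd0 hab hb
  replace s4 := s4.mono hd0 hab hb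
  replace s5 := s5.mono hd0 hab hb
  replace s6 := s6.mono hd0 hab hb
  have hsub : ∀ x ∈ Icc d (β - d), x ∈ Ioo 0 β := fun x hx =>
    ⟨by linarith [hx.1], by linarith [hx.2]⟩
  have hsubL : ∀ x ∈ Icc d (β - d), x ∈ Ioo 0 L := fun x hx =>
    ⟨by linarith [hx.1], by linarith [hx.2]⟩
  have hsubU : ∀ x ∈ Icc d (β - d), x ∈ Ioo 0 β ∪ Ioo β L := fun x hx => Or.inl (hsub x hx)
  -- first order unknowns times the frequency
  have lv1 : BrBd d (β - d) (fun n x => (S.lam n : ℂ) * S.v1 n x) := by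
    refine ((b2.add hab (s1.bd.smul_zero hab hinv2).bd).smul (-Complex.I)).congr hab ?_
    intro n x hx
    have e := S.eq1 n x (hsubU x hx)
    rw [hm] at e
    linear_combination (-Complex.I) * e + (S.lam n : ℂ) * S.v1 n x * Complex.I_sq
  have lv3 : BrBd d (β - d) (fun n x => (S.lam n : ℂ) * S.v3 n x) := by
    refine ((b4.add hab (s3.bd.smul_zero hab hinv2).bd).smul (-Complex.I)).congr hab ?_
    intro n x hx
    have e := S.eq3 n x (hsubU x hx)
    rw [hm] at e
    linear_combination (-Complex.I) * e + (S.lam n : ℂ) * S.v3 n x * Complex.I_sq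
  have lv5 : BrSm d (β - d) (fun n x => (S.lam n : ℂ) ^ 2 * S.v5 n x) := by
    refine ((sv6.add hab (s5.bd.smul_zero hab hinv)).smul (-Complex.I)).congr hab ?_
    intro n x hx
    have e := S.eq5 n x (hsubU x hx)
    rw [hm] at e
    have h2 : (S.lam n : ℂ) * (S.lam n : ℂ)⁻¹ = 1 := mul_inv_cancel₀ (hl0 n)
    linear_combination (-Complex.I) * (S.lam n : ℂ) * e
      + (S.lam n : ℂ) ^ 2 * S.v5 n x * Complex.I_sq
      - Complex.I * (S.lam n : ℂ)⁻¹ * S.f5 n x * h2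
  have sv1 : BrSm d (β - d) S.v1 := by
    refine (lv1.smul_zero hab hinv).congr hab fun n x _ => ?_
    rw [inv_mul_cancel_left₀ (hl0 n)]
  have sv3 : BrSm d (β - d) S.v3 := by
    refine (lv3.smul_zero hab hinv).congr hab fun n x _ => ?_
    rw [inv_mul_cancel_left₀ (hl0 n)]
  have sv5 : BrSm d (β - d) S.v5 := by
    refine (lv5.bd.smul_zero hab hinv2).congr hab fun n x _ => ?_
    have := hl0 n
    field_simp
  have sv6' : BrSm d (β - d) S.v6 := by
    refine (sv6.bd.smul_zero hab hinv).congr hab fun n x _ => ?_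
    rw [inv_mul_cancel_left₀ (hl0 n)]
  have bp1 : BrBd d (β - d) (fun n => deriv (S.v1 n)) := by
    refine ((bT.add hab (sv3.bd.smul (-1))).add hab (sv5.bd.smul (-(l : ℂ)))).congr hab ?_
    intro n x hx
    simp only [brT, br_dw (hsubL x hx)]
    ring
  have bp3 : BrBd d (β - d) (fun n => deriv (S.v3 n)) := by
    refine bP.congr hab ?_
    intro n x hx
    simp only [brP, br_dw (hsubL x hx)]
  have bp5 : BrBd d (β - d) (fun n => deriv (S.v5 n)) := by
    refine (bR.add hab (sv1.bd.smul (l : ℂ))).congr hab ?_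
    intro n x hx
    simp only [brR, br_dw (hsubL x hx)]
    ring
  have w1 := fun n => br_c2 (S.reg_v1 n)
  have w3 := fun n => br_c2 (S.reg_v3 n)
  have w5 := fun n => br_c2 (S.reg_v5_left n)
  have sg1 := ((sv1.smul ((l : ℂ) ^ 2 * k₃)).add hab
    ((s1.bd.smul_zero hab hinv).smul (-(Complex.I * ρ₁)))).add hab
    ((s2.bd.smul_zero hab hinv2).smul (-(ρ₁ : ℂ)))
  have sg3 := (((sv3.smul (k₁ : ℂ)).add hab (sv5.smul ((k₁ : ℂ) * l))).add hab
    ((s3.bd.smul_zero hab hinv).smul (-(Complex.I * ρ₂)))).add hab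
    ((s4.bd.smul_zero hab hinv2).smul (-(ρ₂ : ℂ)))
  have sg5 := ((((sv3.smul ((l : ℂ) * k₁)).add hab (sv5.smul ((l : ℂ) ^ 2 * k₁))).add hab
    (sv6'.smul (a₀ : ℂ))).add hab
    ((s5.bd.smul_zero hab hinv).smul (-(Complex.I * ρ₁)))).add hab
    ((s6.bd.smul_zero hab hinv2).smul (-(ρ₁ : ℂ)))
  have loc : BrLoc ρ₁ ρ₂ k₁ k₂ k₃ l S.lam S.v1 S.v3 S.v5 (fun n => deriv (S.v1 n))
      (fun n => deriv (S.v3 n)) (fun n => deriv (S.v5 n)) (fun n => deriv (deriv (S.v1 n)))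
      (fun n => deriv (deriv (S.v3 n))) (fun n => deriv (deriv (S.v5 n))) _ _ _ d (β - d) :=
    { hab := hab
      hu1 := fun n x hx => (w1 n).1 x (hsubL x hx)
      hu3 := fun n x hx => (w3 n).1 x (hsubL x hx)
      hu5 := fun n x hx => (w5 n).1 x (hsub x hx)
      hp1 := fun n x hx => (w1 n).2.1 x (hsubL x hx)
      hp3 := fun n x hx => (w3 n).2.1 x (hsubL x hx)
      hp5 := fun n x hx => (w5 n).2.1 x (hsub x hx)
      cq1 := fun n => (w1 n).2.2.mono hsubL
      cq3 := fun n => (w3 n).2.2.mono hsubL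
      cq5 := fun n => (w5 n).2.2.mono hsub
      sg1 := sg1
      sg3 := sg3
      sg5 := sg5
      bp1 := bp1
      bp3 := bp3
      bp5 := bp5
      bu1 := lv1
      bu3 := lv3
      su5 := lv5
      e1 := by
        intro n x hx
        have e := S.eq2 n x (hsubU x hx)
        have h := ((((w1 n).2.1 x (hsubL x hx)).add ((w3 n).1 x (hsubL x hx))).add
          (((w5 n).1 x (hsub x hx)).const_mul (l : ℂ)))
        have h' : HasDerivAt (fun y => deriv (S.v1 n) y + S.v3 n y + (l : ℂ) * S.v5 n y) _ x := h
        have e1 := S.eq1 n x (hsubU x hx)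
        rw [h'.deriv] at e
        rw [hm] at e e1
        have h2 : (S.lam n : ℂ) * (S.lam n : ℂ)⁻¹ = 1 := mul_inv_cancel₀ (hl0 n)
        push_cast
        linear_combination -e - Complex.I * (S.lam n : ℂ) * ρ₁ * e1
          + (ρ₁ : ℂ) * (S.lam n : ℂ) ^ 2 * S.v1 n x * Complex.I_sq
          - Complex.I * ρ₁ * (S.lam n : ℂ)⁻¹ * S.f1 n x * h2
      e3 := by
        intro n x hx
        have e := S.eq4 n x (hsubU x hx)
        have e1 := S.eq3 n x (hsubU x hx)
        rw [hm] at e e1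
        have h2 : (S.lam n : ℂ) * (S.lam n : ℂ)⁻¹ = 1 := mul_inv_cancel₀ (hl0 n)
        linear_combination -e - Complex.I * (S.lam n : ℂ) * ρ₂ * e1
          + (ρ₂ : ℂ) * (S.lam n : ℂ) ^ 2 * S.v3 n x * Complex.I_sq
          - Complex.I * ρ₂ * (S.lam n : ℂ)⁻¹ * S.f3 n x * h2
      e5 := by
        intro n x hx
        have e := S.eq6 n x (hsubU x hx)
        have h := (((w5 n).2.1 x (hsub x hx)).sub
          (((w1 n).1 x (hsubL x hx)).const_mul (l : ℂ)))
        have h' : HasDerivAt (fun y => deriv (S.v5 n) y - (l : ℂ) * S.v1 n y) _ x := h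
        have e1 := S.eq5 n x (hsubU x hx)
        rw [h'.deriv, if_pos (hsub x hx).2] at e
        rw [hm] at e e1
        have h2 : (S.lam n : ℂ) * (S.lam n : ℂ)⁻¹ = 1 := mul_inv_cancel₀ (hl0 n)
        push_cast
        linear_combination -e - Complex.I * (S.lam n : ℂ) * ρ₁ * e1
          + (ρ₁ : ℂ) * (S.lam n : ℂ) ^ 2 * S.v5 n x * Complex.I_sq
          - Complex.I * ρ₁ * (S.lam n : ℂ)⁻¹ * S.f5 n x * h2 }
  exact loc.final hr1 hr2 hk1 hk2 hk3 hl S.lam_ne hinv hkr hd hdβ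

end fin


theorem bresse_lemma6_H2 (ρ₁ ρ₂ k₁ k₂ k₃ l L β a₀ : ℝ) (ℓ : ℕ)
    (hrho1 : 0 < ρ₁) (hrho2 : 0 < ρ₂) (hk1 : 0 < k₁) (hk2 : 0 < k₂) (hk3 : 0 < k₃)
    (hl : 0 < l) (hL : 0 < L) (ha0 : 0 < a₀) (hbeta : 0 < β) (hbetaL : β < L)
    (S : BresseSetting ρ₁ ρ₂ k₁ k₂ k₃ l L β a₀ ℓ)
    (hH : k₁ / ρ₁ = k₂ / ρ₂ ∧ k₁ ≠ k₃ ∧ ℓ = 2) :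
    ∀ ε : ℝ, 0 < ε → ε < β / 12 →
    Tendsto (fun n => ∫ x in (4 * ε)..(β - 4 * ε), ‖deriv (S.v3 n) x‖ ^ 2) atTop (nhds 0) ∧
    Tendsto (fun n => (S.lam n) ^ 2 * ∫ x in (5 * ε)..(β - 5 * ε), ‖S.v3 n x‖ ^ 2)
      atTop (nhds 0) := by
  obtain ⟨hkr, -, rfl⟩ := hH
  intro ε hε hεβ
  have hkr' : k₁ * ρ₂ = k₂ * ρ₁ := (div_eq_div_iff hrho1.ne' hrho2.ne').1 hkr
  obtain ⟨h1, h2⟩ := br_main S hL hrho1 hrho2 hk1 hk2 hk3 ha0 hbeta hbetaL hl hkr'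
    (d := ε / 2) (by linarith) (by linarith)
  refine ⟨(h1.mono (a' := 4 * ε) (b' := β - 4 * ε) (by linarith) (by linarith) (by linarith)).2,
    ?_⟩
  have h3 := (h2.mono (a' := 5 * ε) (b' := β - 5 * ε)
    (by linarith) (by linarith) (by linarith)).2
  refine h3.congr fun n => ?_
  rw [br_smul_sq, Complex.norm_real, Real.norm_eq_abs, sq_abs]
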